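/- Let (A,𝔪) be a commutative Noetherian local ring which is a local complete intersection: the 𝔪-adic completion Â of A admits a surjective ring homomorphism π : Q → Â from a regular local ring (Q,𝔫) whose kernel is generated by a Q-regular sequence f_1,…,f_c ∈ 𝔫². Let M and N be finitely generated A-modules and let I be a proper ideal of A. Then the complexity cx_A(M, I^j N) is constant for all sufficiently large j; that is, there exists j_0 such that cx_A(M, I^j N) = cx_A(M, I^{j_0} N) for all j ≥ j_0. -/

import Mathlib

open CategoryTheory

/-- The `i`-th Ext module `Ext^i_A(M, N)` of `A`-modules, as a type. -/
noncomputable abbrev extAP (A : Type) [CommRing A] (M N : Type) [AddCommGroup M] [Module A M]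
    [AddCommGroup N] [Module A N] (i : ℕ) : Type :=
  ((Ext A (ModuleCat A) i).obj (Opposite.op (ModuleCat.of A M))).obj (ModuleCat.of A N)

/-- The minimal number of generators `μ(E) = dim_k (E ⊗_A k)` of a module over a local
ring `(A, 𝔪)` with residue field `k`. -/
noncomputable def minGens (A : Type) [CommRing A] [IsLocalRing A]
    (E : Type) [AddCommGroup E] [Module A E] : ℕ :=
  Module.finrank (IsLocalRing.ResidueField A)
    (TensorProduct A (IsLocalRing.ResidueField A) E)

/-- The complexity `cx_A(M,N) = inf { b ∈ ℕ | limsup_n μ(Ext^n_A(M,N))/n^(b-1) < ∞ }` of a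
pair of modules over a local ring `A`. -/
noncomputable def complexity (A : Type) [CommRing A] [IsLocalRing A]
    (M N : Type) [AddCommGroup M] [Module A M] [AddCommGroup N] [Module A N] : ℕ :=
  sInf { b : ℕ |
    Filter.limsup (fun n : ℕ =>
      (minGens A (extAP A M N n) : ENNReal) / (n : ENNReal) ^ ((b : ℤ) - 1))
      Filter.atTop < ⊤ }


section PartA

theorem al_noeth_adjoin {R E : Type} [CommRing R] [IsNoetherianRing R] [AddCommGroup E]
    [Module R E] {ι : Type} [Finite ι] (t : ι → Module.End R E)
    (hc : ∀ i j, t i * t j = t j * t i) :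
    IsNoetherianRing (Algebra.adjoin R (Set.range t)) := by
  let _ : CommRing (Algebra.adjoin R (Set.range t)) := Algebra.adjoinCommRingOfComm R (by
    rintro _ ⟨i, rfl⟩ _ ⟨j, rfl⟩; exact hc i j)
  have : Algebra.FiniteType R (Algebra.adjoin R (Set.range t)) := by
    rw [← Subalgebra.fg_iff_finiteType]
    exact Subalgebra.fg_def.2 ⟨_, Set.finite_range t, rfl⟩
  exact Algebra.FiniteType.isNoetherianRing R _

theorem al_main {R E : Type} [CommRing R] [IsNoetherianRing R] [AddCommGroup E] [Module R E]
    (B Z : Submodule R E) (hBZ : B ≤ Z) (k : ℕ) (τ : ℕ → Module.End R E)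
    (hB : ∀ i < k, ∀ x ∈ B, τ i x ∈ B) (hZ : ∀ i < k, ∀ x ∈ Z, τ i x ∈ Z)
    (hc : ∀ i < k, ∀ j < k, ∀ z ∈ Z, τ i (τ j z) - τ j (τ i z) ∈ B)
    (G : Set E) (hG : G.Finite) (hGZ : ∀ g ∈ G, g ∈ Z)
    (gen : ∀ U : Submodule R E, B ≤ U → (∀ g ∈ G, g ∈ U) → (∀ i < k, ∀ u ∈ U, τ i u ∈ U) → Z ≤ U)
    (V : Submodule R E) (hBV : B ≤ V) (hVZ : V ≤ Z) (hV : ∀ i < k, ∀ x ∈ V, τ i x ∈ V) :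
    ∃ G' : Set E, G'.Finite ∧ (∀ g ∈ G', g ∈ V) ∧
      ∀ U : Submodule R E, B ≤ U → (∀ g ∈ G', g ∈ U) → (∀ i < k, ∀ u ∈ U, τ i u ∈ U) → V ≤ U := by
  classical
  let B' : Submodule R Z := B.comap Z.subtype
  let tz : Fin k → Module.End R Z := fun i => (τ i).restrict (hZ i i.2)
  let t : Fin k → Module.End R (Z ⧸ B') := fun i => B'.mapQ B' (tz i) (fun x hx => hB i i.2 _ hx)
  have htmk : ∀ i (z : Z), t i (B'.mkQ z) = B'.mkQ (tz i z) := fun i z => rfl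
  have hcomm : ∀ i j, t i * t j = t j * t i := by
    intro i j
    apply LinearMap.ext
    intro x
    obtain ⟨z, rfl⟩ := B'.mkQ_surjective x
    simp only [Module.End.mul_apply, htmk]
    refine (Submodule.Quotient.eq B').2 ?_
    exact hc i i.2 j j.2 z z.2
  let S := Algebra.adjoin R (Set.range t)
  have hSN : IsNoetherianRing S := al_noeth_adjoin t hcomm
  -- pulling back
  let pb : Submodule S (Z ⧸ B') → Submodule R E := fun U =>
    ((U.restrictScalars R).comap B'.mkQ).map Z.subtype
  have hpbmem : ∀ U (z : Z), (z : E) ∈ pb U ↔ B'.mkQ z ∈ U := by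
    intro U z
    constructor
    · rintro ⟨w, hw, hwz⟩
      have : w = z := Subtype.ext hwz
      subst this; exact hw
    · intro h; exact ⟨z, h, rfl⟩
  have hpbZ : ∀ U, pb U ≤ Z := by
    rintro U _ ⟨w, hw, rfl⟩; exact w.2
  have hpbB : ∀ U, B ≤ pb U := by
    intro U x hx
    rw [show x = ((⟨x, hBZ hx⟩ : Z) : E) from rfl, hpbmem]
    have : B'.mkQ ⟨x, hBZ hx⟩ = 0 := by
      rw [Submodule.mkQ_apply, Submodule.Quotient.mk_eq_zero]; exact hx
    rw [this]; exact U.zero_mem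
  have hpbτ : ∀ U, ∀ i < k, ∀ u ∈ pb U, τ i u ∈ pb U := by
    intro U i hi u hu
    have h1 := (hpbmem U ⟨u, hpbZ U hu⟩).1 hu
    have h2 := U.smul_mem (⟨t ⟨i, hi⟩, Algebra.subset_adjoin ⟨_, rfl⟩⟩ : S) h1
    exact (hpbmem U (tz ⟨i, hi⟩ ⟨u, hpbZ U hu⟩)).2 h2
  -- finite
  let GZ : Set Z := Subtype.val ⁻¹' G
  have hGZf : GZ.Finite := hG.preimage Subtype.val_injective.injOn
  have hfin : Module.Finite S (Z ⧸ B') := by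
    refine ⟨Submodule.fg_def.2 ⟨B'.mkQ '' GZ, hGZf.image _, ?_⟩⟩
    rw [eq_top_iff]
    rintro x -
    obtain ⟨z, rfl⟩ := B'.mkQ_surjective x
    rw [← hpbmem]
    refine gen _ (hpbB _) ?_ (hpbτ _) z.2
    intro g hg
    rw [show g = ((⟨g, hGZ g hg⟩ : Z) : E) from rfl, hpbmem]
    exact Submodule.subset_span ⟨_, hg, rfl⟩
  have hNoeth : IsNoetherian S (Z ⧸ B') := isNoetherian_of_isNoetherianRing_of_finite S _
  -- submodules from stable
  have mkS : ∀ U : Submodule R E, (∀ i < k, ∀ u ∈ U, τ i u ∈ U) →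
      ∃ U' : Submodule S (Z ⧸ B'), U'.restrictScalars R = (U.comap Z.subtype).map B'.mkQ := by
    intro U hU
    refine ⟨{ (U.comap Z.subtype).map B'.mkQ with smul_mem' := ?_ }, rfl⟩
    rintro ⟨s, hs⟩ x hx
    change s x ∈ (U.comap Z.subtype).map B'.mkQ
    replace hx : x ∈ (U.comap Z.subtype).map B'.mkQ := hx
    induction hs using Algebra.adjoin_induction generalizing x with
    | mem s hs =>
      obtain ⟨i, rfl⟩ := hs
      obtain ⟨z, hz, rfl⟩ := hx
      exact ⟨tz i z, hU i i.2 _ hz, rfl⟩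
    | algebraMap r => exact Submodule.smul_mem _ r hx
    | add a b _ _ ha hb => exact Submodule.add_mem _ (ha hx) (hb hx)
    | mul a b _ _ ha hb => exact ha (hb hx)
  obtain ⟨V', hV'⟩ := mkS V hV
  obtain ⟨T, hT⟩ := (IsNoetherian.noetherian V')
  have hmemV : ∀ x, x ∈ V' ↔ ∃ z : Z, (z : E) ∈ V ∧ B'.mkQ z = x := by
    intro x
    rw [← Submodule.restrictScalars_mem R, hV']; rfl
  have hch : ∀ x : T, ∃ z : Z, (z : E) ∈ V ∧ B'.mkQ z = x := by
    intro x
    rw [← hmemV, ← hT]; exact Submodule.subset_span x.2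
  choose c hcV hcx using hch
  refine ⟨Set.range (fun x => (c x : E)), Set.finite_range _, ?_, ?_⟩
  · rintro _ ⟨x, rfl⟩; exact hcV x
  · intro U hBU hgU hU v hv
    obtain ⟨U', hU'⟩ := mkS U hU
    have hle : V' ≤ U' := by
      rw [← hT, Submodule.span_le]
      intro x hx
      have : x ∈ U'.restrictScalars R := by
        rw [hU']; exact ⟨c ⟨x, hx⟩, hgU _ ⟨_, rfl⟩, hcx _⟩
      exact this
    have hvm : B'.mkQ ⟨v, hVZ hv⟩ ∈ U'.restrictScalars R := hle ((hmemV _).2 ⟨_, hv, rfl⟩)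
    rw [hU'] at hvm
    obtain ⟨z, hz, hzv⟩ := hvm
    have h3 := (Submodule.Quotient.eq B').1 hzv
    have h4 : (z : E) - v ∈ U := hBU h3
    have h5 : (z : E) ∈ U := hz
    simpa using U.sub_mem h5 h4

end PartA


namespace CxProof

section Graded

variable {Q X ι : Type} [CommRing Q] [AddCommGroup X] [Module Q X]
  (b : Module.Basis ι Q X) (gr : ι → ℤ)

/-- projection to degree `n`. -/
noncomputable def pj (n : ℤ) : Module.End Q X :=
  b.constr Q (fun i => if gr i = n then b i else 0)

theorem pj_b (n : ℤ) (i : ι) : pj b gr n (b i) = if gr i = n then b i else 0 := by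
  simp [pj, Module.Basis.constr_basis]

theorem repr_pj (n : ℤ) (x : X) (l : ι) :
    b.repr (pj b gr n x) l = if gr l = n then b.repr x l else 0 := by
  classical
  have key : Finsupp.lapply l ∘ₗ b.repr.toLinearMap ∘ₗ pj b gr n =
      (if gr l = n then (1 : Q) else 0) • (Finsupp.lapply l ∘ₗ b.repr.toLinearMap) := by
    refine b.ext fun i => ?_
    simp only [LinearMap.comp_apply, pj_b, LinearMap.smul_apply, LinearEquiv.coe_coe,
      Finsupp.lapply_apply]
    by_cases h : gr i = n
    · by_cases hl : i = l
      · subst hl; simp [h]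
      · simp [h, Finsupp.single_apply, hl]
    · by_cases hl : i = l
      · subst hl; simp [h]
      · simp [h, Finsupp.single_apply, hl]
  have := LinearMap.congr_fun key x
  simp only [LinearMap.comp_apply, LinearMap.smul_apply, LinearEquiv.coe_coe,
    Finsupp.lapply_apply, ite_smul, one_smul, zero_smul] at this
  split_ifs at this ⊢ <;> simpa using this

theorem pj_mul_self (n : ℤ) : pj b gr n * pj b gr n = pj b gr n := by
  refine b.ext fun i => ?_
  simp only [Module.End.mul_apply, pj_b]
  split_ifs with h
  · simp [pj_b, h]
  · simp

theorem pj_mul_ne {m n : ℤ} (h : m ≠ n) : pj b gr m * pj b gr n = 0 := by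
  refine b.ext fun i => ?_
  simp only [Module.End.mul_apply, pj_b]
  split_ifs with h'
  · simp [pj_b, h', h.symm]
  · simp

/-- homogeneous operators of degree `e`. -/
def Hm (e : ℤ) (a : Module.End Q X) : Prop := ∀ n, a * pj b gr n = pj b gr (n + e) * a

variable {b gr}

theorem Hm_iff {e : ℤ} {a : Module.End Q X} :
    Hm b gr e a ↔ ∀ i l, b.repr (a (b i)) l ≠ 0 → gr l = gr i + e := by
  constructor
  · intro h i l hl
    have h1 := congrArg (fun g : Module.End Q X => b.repr (g (b i)) l) (h (gr i))
    simp only [Module.End.mul_apply, pj_b, if_true, repr_pj] at h1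
    by_contra hne
    rw [if_neg hne] at h1
    exact hl h1
  · intro h n
    refine b.ext fun i => b.repr.injective (Finsupp.ext fun l => ?_)
    simp only [Module.End.mul_apply, pj_b, repr_pj]
    by_cases h0 : b.repr (a (b i)) l = 0
    · split_ifs <;> simp [h0]
    · have := h i l h0
      by_cases hi : gr i = n
      · rw [if_pos hi, if_pos (by omega)]
      · rw [if_neg hi, if_neg (by omega)]; simp

theorem Hm.add {e : ℤ} {a a' : Module.End Q X} (h : Hm b gr e a) (h' : Hm b gr e a') :
    Hm b gr e (a + a') := fun n => by rw [add_mul, mul_add, h n, h' n]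

theorem Hm.neg {e : ℤ} {a : Module.End Q X} (h : Hm b gr e a) : Hm b gr e (-a) :=
  fun n => by rw [neg_mul, mul_neg, h n]

theorem Hm.sub {e : ℤ} {a a' : Module.End Q X} (h : Hm b gr e a) (h' : Hm b gr e a') :
    Hm b gr e (a - a') := fun n => by rw [sub_mul, mul_sub, h n, h' n]

theorem Hm.smul {e : ℤ} {a : Module.End Q X} (r : Q) (h : Hm b gr e a) : Hm b gr e (r • a) :=
  fun n => by rw [smul_mul_assoc, mul_smul_comm, h n]

theorem Hm.zero {e : ℤ} : Hm b gr e (0 : Module.End Q X) := fun n => by simp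

theorem Hm.mul {e e' : ℤ} {a a' : Module.End Q X} (h : Hm b gr e a) (h' : Hm b gr e' a') :
    Hm b gr (e + e') (a * a') := fun n => by
  rw [mul_assoc, h' n, ← mul_assoc, h, mul_assoc]; congr 2; ring

theorem Hm.cast {e e' : ℤ} {a : Module.End Q X} (h : Hm b gr e a) (he : e = e') :
    Hm b gr e' a := he ▸ h

end Graded

section JSec

variable {Q : Type} [CommRing Q] (f : ℕ → Q)

/-- the submodule `(f_0,…,f_{k-1}) Y`. -/
def JS (k : ℕ) (Y : Type) [AddCommGroup Y] [Module Q Y] : Submodule Q Y where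
  carrier := {y | ∃ c : ℕ → Y, y = ∑ i ∈ Finset.range k, f i • c i}
  add_mem' := by
    rintro _ _ ⟨c, rfl⟩ ⟨c', rfl⟩
    exact ⟨fun i => c i + c' i, by simp [Finset.sum_add_distrib]⟩
  zero_mem' := ⟨fun _ => 0, by simp⟩
  smul_mem' := by
    rintro r _ ⟨c, rfl⟩
    exact ⟨fun i => r • c i, by simp [Finset.smul_sum, smul_comm r]⟩

variable {f}

theorem mem_JS {k : ℕ} {Y : Type} [AddCommGroup Y] [Module Q Y] {y : Y} :
    y ∈ JS f k Y ↔ ∃ c : ℕ → Y, y = ∑ i ∈ Finset.range k, f i • c i := Iff.rfl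

theorem JS_map {k : ℕ} {Y Y' : Type} [AddCommGroup Y] [Module Q Y] [AddCommGroup Y'] [Module Q Y']
    (g : Y →ₗ[Q] Y') {y : Y} (h : y ∈ JS f k Y) : g y ∈ JS f k Y' := by
  obtain ⟨c, rfl⟩ := h
  exact ⟨fun i => g (c i), by simp⟩

theorem mem_JS_succ {k : ℕ} {Y : Type} [AddCommGroup Y] [Module Q Y] {y : Y} :
    y ∈ JS f (k + 1) Y ↔ ∃ w, y - f k • w ∈ JS f k Y := by
  constructor
  · rintro ⟨c, rfl⟩
    exact ⟨c k, c, by rw [Finset.sum_range_succ]; abel⟩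
  · rintro ⟨w, c, hc⟩
    refine ⟨fun i => if i = k then w else c i, ?_⟩
    rw [Finset.sum_range_succ]
    simp only [if_true]
    rw [eq_add_of_sub_eq hc]
    congr 1
    refine Finset.sum_congr rfl fun i hi => ?_
    rw [if_neg (Finset.mem_range.1 hi).ne]

theorem JS_le_succ {k : ℕ} {Y : Type} [AddCommGroup Y] [Module Q Y] : JS f k Y ≤ JS f (k + 1) Y :=
  fun y hy => mem_JS_succ.2 ⟨0, by simpa using hy⟩

theorem smul_mem_JS_succ {k : ℕ} {Y : Type} [AddCommGroup Y] [Module Q Y] (y : Y) :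
    f k • y ∈ JS f (k + 1) Y :=
  mem_JS_succ.2 ⟨y, by simp⟩

theorem JS_zero {Y : Type} [AddCommGroup Y] [Module Q Y] : JS f 0 Y = ⊥ := by
  ext y; simp [mem_JS]

variable (f) in
/-- regularity of the sequence. -/
def Reg (c : ℕ) : Prop := ∀ k < c, ∀ y : Q, f k * y ∈ JS f k Q → y ∈ JS f k Q

variable {X ι : Type} [AddCommGroup X] [Module Q X]
  {b : Module.Basis ι Q X} {gr : ι → ℤ}

theorem JS_repr {k : ℕ} (b : Module.Basis ι Q X) {x : X} :
    x ∈ JS f k X ↔ ∀ l, b.repr x l ∈ JS f k Q := by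
  constructor
  · intro h l
    exact JS_map (Finsupp.lapply l ∘ₗ b.repr.toLinearMap) h
  · intro h
    choose c hc using h
    refine ⟨fun m => ∑ l ∈ (b.repr x).support, c l m • b l, ?_⟩
    conv_lhs => rw [← b.linearCombination_repr x, Finsupp.linearCombination_apply, Finsupp.sum]
    simp only [Finset.smul_sum]
    rw [Finset.sum_comm]
    refine Finset.sum_congr rfl fun l _ => ?_
    conv_lhs => rw [hc l]
    rw [Finset.sum_smul]
    simp [mul_smul]

theorem Reg.mod {c : ℕ} (hr : Reg f c) {k : ℕ} (hk : k < c) (b : Module.Basis ι Q X) {x : X}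
    (h : f k • x ∈ JS f k X) : x ∈ JS f k X := by
  rw [JS_repr b] at h ⊢
  intro l
  refine hr k hk _ ?_
  simpa using h l

variable (f b gr) in
/-- operators in `(f_0,…,f_{k-1})` times homogeneous operators. -/
def OJ (k : ℕ) (e : ℤ) (a : Module.End Q X) : Prop :=
  ∃ c : ℕ → Module.End Q X, (∀ i, Hm b gr e (c i)) ∧ a = ∑ i ∈ Finset.range k, f i • c i

theorem OJ_of_coeff {k : ℕ} {e : ℤ} {a : Module.End Q X} (ha : Hm b gr e a)
    (h : ∀ i l, b.repr (a (b i)) l ∈ JS f k Q) : OJ f b gr k e a := by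
  classical
  choose c hc using h
  refine ⟨fun m => b.constr Q (fun i => ∑ l ∈ (b.repr (a (b i))).support, c i l m • b l), ?_, ?_⟩
  · intro m
    rw [Hm_iff]
    intro i l hl
    rw [Module.Basis.constr_basis] at hl
    refine Hm_iff.1 ha i l fun h0 => hl ?_
    rw [map_sum, Finsupp.finsetSum_apply]
    refine Finset.sum_eq_zero fun l' hl' => ?_
    have : l' ≠ l := by rintro rfl; exact (Finsupp.mem_support_iff.1 hl') h0
    simp [Finsupp.single_apply, this]
  · refine b.ext fun i => ?_
    rw [LinearMap.sum_apply]
    simp only [LinearMap.smul_apply, Module.Basis.constr_basis]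
    conv_lhs => rw [← b.linearCombination_repr (a (b i)), Finsupp.linearCombination_apply, Finsupp.sum]
    simp only [Finset.smul_sum]
    rw [Finset.sum_comm]
    refine Finset.sum_congr rfl fun l _ => ?_
    conv_lhs => rw [hc i l]
    rw [Finset.sum_smul]
    simp [mul_smul]

theorem OJ_reg {c : ℕ} (hr : Reg f c) {k : ℕ} (hk : k < c) {e : ℤ} {a : Module.End Q X}
    (ha : Hm b gr e a) (cc : ℕ → Module.End Q X)
    (h : f k • a = ∑ i ∈ Finset.range k, f i • cc i) : OJ f b gr k e a := by
  refine OJ_of_coeff ha fun i l => ?_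
  have h2 : a (b i) ∈ JS f k X := by
    refine hr.mod hk b ⟨fun m => cc m (b i), ?_⟩
    have := congrArg (fun g : Module.End Q X => g (b i)) h
    simpa [LinearMap.sum_apply] using this
  exact (JS_repr b).1 h2 l

theorem OJ_kz {c : ℕ} (hr : Reg f c) {e : ℤ} : ∀ (k : ℕ), k ≤ c → ∀ (a : ℕ → Module.End Q X),
    (∀ i < k, Hm b gr e (a i)) → ∑ i ∈ Finset.range k, f i • a i = 0 →
    ∀ i < k, OJ f b gr k e (a i) := by
  intro k
  induction k with
  | zero => intro _ _ _ _ i hi; omega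
  | succ k ih =>
    intro hk a ha hs
    rw [Finset.sum_range_succ] at hs
    obtain ⟨cc, hcc, hak⟩ := OJ_reg hr (Nat.lt_of_succ_le hk) (ha k (Nat.lt_succ_self k))
      (fun i => - a i) (by
        rw [eq_neg_of_add_eq_zero_right hs]; simp)
    have h2 := ih (by omega) (fun i => a i + f k • cc i)
      (fun i hi => (ha i (by omega)).add ((hcc i).smul _)) (by
        rw [← hs, hak, Finset.smul_sum, ← Finset.sum_add_distrib]
        refine Finset.sum_congr rfl fun i _ => ?_
        rw [smul_add, smul_comm])
    intro i hi
    rcases Nat.lt_succ_iff_lt_or_eq.1 hi with hi | rfl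
    · obtain ⟨v, hv, hva⟩ := h2 i hi
      refine ⟨fun l => if l = k then - cc i else v l, ?_, ?_⟩
      · intro l; dsimp only; split_ifs
        · exact (hcc i).neg
        · exact hv l
      · rw [Finset.sum_range_succ]
        simp only [if_true]
        have : ∑ x ∈ Finset.range k, f x • (if x = k then - cc i else v x)
            = ∑ x ∈ Finset.range k, f x • v x :=
          Finset.sum_congr rfl fun x hx => by rw [if_neg (Finset.mem_range.1 hx).ne]
        rw [this, ← hva]; simp
    · refine ⟨fun l => if l = i then 0 else cc l, ?_, ?_⟩
      · intro l; dsimp only; split_ifs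
        · exact Hm.zero
        · exact hcc l
      · rw [Finset.sum_range_succ]
        simp only [if_true]
        conv_lhs => rw [hak]
        simp only [smul_zero, add_zero]
        exact Finset.sum_congr rfl fun x hx => by rw [if_neg (Finset.mem_range.1 hx).ne]

end JSec

end CxProof


namespace CxProof

section Efin

variable {Q X ι : Type} [CommRing Q] [AddCommGroup X] [Module Q X]
  {W R : Type} [CommRing R] [AddCommGroup W] [Module Q W] [Module R W] [SMulCommClass Q R W]

variable (R W) in
/-- precomposition. -/
def pre (a : Module.End Q X) : Module.End R (X →ₗ[Q] W) where
  toFun u := u ∘ₗ a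
  map_add' u v := LinearMap.add_comp _ _ _
  map_smul' r u := rfl

@[simp] theorem pre_apply (a : Module.End Q X) (u : X →ₗ[Q] W) : pre W R a u = u ∘ₗ a := rfl

variable (b : Module.Basis ι Q X) (gr : ι → ℤ)

variable (R W) in
/-- cochains with finitely many nonzero components. -/
def Ef : Submodule R (X →ₗ[Q] W) where
  carrier := {u | ∃ N : ℤ, ∀ n > N, u ∘ₗ pj b gr n = 0}
  add_mem' := by
    rintro u v ⟨N, hN⟩ ⟨N', hN'⟩
    refine ⟨max N N', fun n hn => ?_⟩
    rw [LinearMap.add_comp, hN n (lt_of_le_of_lt (le_max_left _ _) hn),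
      hN' n (lt_of_le_of_lt (le_max_right _ _) hn), add_zero]
  zero_mem' := ⟨0, fun n _ => by simp⟩
  smul_mem' := by
    rintro r u ⟨N, hN⟩
    refine ⟨N, fun n hn => ?_⟩
    have := hN n hn
    rw [LinearMap.smul_comp, this, smul_zero]

variable (R W) in
/-- cocycles. -/
def Zc (d : Module.End Q X) : Submodule R (X →ₗ[Q] W) := Ef W R b gr ⊓ LinearMap.ker (pre W R d)

variable (R W) in
/-- coboundaries. -/
def Bc (d : Module.End Q X) : Submodule R (X →ₗ[Q] W) := (Ef W R b gr).map (pre W R d)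

variable {b gr}

theorem mem_Zc {d : Module.End Q X} {u : X →ₗ[Q] W} :
    u ∈ Zc W R b gr d ↔ u ∈ Ef W R b gr ∧ u ∘ₗ d = 0 := Iff.rfl

theorem mem_Bc {d : Module.End Q X} {u : X →ₗ[Q] W} :
    u ∈ Bc W R b gr d ↔ ∃ v ∈ Ef W R b gr, v ∘ₗ d = u := Iff.rfl

theorem Hm.comp {e : ℤ} {a : Module.End Q X} (ha : Hm b gr e a) (u : X →ₗ[Q] W) (n : ℤ) :
    (u ∘ₗ a) ∘ₗ pj b gr n = (u ∘ₗ pj b gr (n + e)) ∘ₗ a := by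
  rw [LinearMap.comp_assoc, LinearMap.comp_assoc]
  exact congrArg _ (ha n)

theorem Ef_comp {e : ℤ} {a : Module.End Q X} (ha : Hm b gr e a) {u : X →ₗ[Q] W}
    (hu : u ∈ Ef W R b gr) : u ∘ₗ a ∈ Ef W R b gr := by
  obtain ⟨N, hN⟩ := hu
  refine ⟨N - e, fun n hn => ?_⟩
  rw [ha.comp, hN _ (by omega), LinearMap.zero_comp]

theorem comp_pj_self (u : X →ₗ[Q] W) (n : ℤ) :
    (u ∘ₗ pj b gr n) ∘ₗ pj b gr n = u ∘ₗ pj b gr n := by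
  rw [LinearMap.comp_assoc]; exact congrArg _ (pj_mul_self b gr n)

theorem comp_pj_ne (u : X →ₗ[Q] W) {m n : ℤ} (h : m ≠ n) :
    (u ∘ₗ pj b gr m) ∘ₗ pj b gr n = 0 := by
  rw [LinearMap.comp_assoc]
  exact (congrArg (fun g => u ∘ₗ g) (pj_mul_ne b gr h)).trans (LinearMap.comp_zero _)

theorem Ef_pj (u : X →ₗ[Q] W) (n : ℤ) : u ∘ₗ pj b gr n ∈ Ef W R b gr :=
  ⟨n, fun m hm => comp_pj_ne u (by omega)⟩

theorem pj_neg (h0 : ∀ i, 0 ≤ gr i) {n : ℤ} (hn : n < 0) : pj b gr n = 0 := by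
  refine b.ext fun i => ?_
  rw [pj_b, if_neg (by have := h0 i; omega)]; rfl

theorem Ef_sum (h0 : ∀ i, 0 ≤ gr i) {u : X →ₗ[Q] W} {N : ℤ}
    (hN : ∀ n > N, u ∘ₗ pj b gr n = 0) :
    u = ∑ n ∈ Finset.Icc 0 N, u ∘ₗ pj b gr n := by
  refine b.ext fun i => ?_
  rw [LinearMap.sum_apply]
  simp only [LinearMap.comp_apply, pj_b]
  by_cases h : gr i ≤ N
  · rw [Finset.sum_eq_single (gr i)]
    · simp
    · intro n _ hn
      rw [if_neg hn.symm, map_zero]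
    · intro h'
      exact absurd (Finset.mem_Icc.2 ⟨h0 i, h⟩) h'
  · rw [Finset.sum_eq_zero]
    · have := LinearMap.congr_fun (hN (gr i) (by omega)) (b i)
      simpa [pj_b] using this
    · intro n hn
      have := (Finset.mem_Icc.1 hn).2
      rw [if_neg (by omega), map_zero]

theorem Ef_mem_of (h0 : ∀ i, 0 ≤ gr i) {u : X →ₗ[Q] W} (hu : u ∈ Ef W R b gr)
    (U : Submodule R (X →ₗ[Q] W)) (h : ∀ n, u ∘ₗ pj b gr n ∈ U) : u ∈ U := by
  obtain ⟨N, hN⟩ := hu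
  rw [Ef_sum h0 hN]
  exact Submodule.sum_mem _ fun n _ => h n

theorem Zc_pj {e : ℤ} {d : Module.End Q X} (hd : Hm b gr e d) {u : X →ₗ[Q] W}
    (hu : u ∈ Zc W R b gr d) (n : ℤ) : u ∘ₗ pj b gr n ∈ Zc W R b gr d := by
  refine mem_Zc.2 ⟨Ef_pj u n, ?_⟩
  have := hd.comp u (n - e)
  rw [sub_add_cancel] at this
  rw [← this, (mem_Zc.1 hu).2, LinearMap.zero_comp]

theorem OJ_comp {f : ℕ → Q} {k : ℕ} {e : ℤ} {a : Module.End Q X} (ha : OJ f b gr k e a)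
    (hf : ∀ i < k, ∀ w : W, f i • w = 0) (u : X →ₗ[Q] W) : u ∘ₗ a = 0 := by
  obtain ⟨c, -, rfl⟩ := ha
  ext x
  simp only [LinearMap.comp_apply, LinearMap.sum_apply, LinearMap.smul_apply, map_sum, map_smul,
    LinearMap.zero_apply]
  exact Finset.sum_eq_zero fun i hi => hf i (Finset.mem_range.1 hi) _

end Efin

section Levels

variable {Q : Type} [CommRing Q] (f : ℕ → Q)

/-- a free graded module with an endomorphism squaring into `(f_0,…,f_{k-1})`, exact modulo it. -/
structure Lev {X ι : Type} [AddCommGroup X] [Module Q X] (k : ℕ) (b : Module.Basis ι Q X)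
    (gr : ι → ℤ) (d : Module.End Q X) (T : ℕ → Module.End Q X) : Prop where
  hd : Hm b gr (-1) d
  hT : ∀ i, Hm b gr (-2) (T i)
  sq : d * d = ∑ i ∈ Finset.range k, f i • T i
  gr0 : ∀ i, 0 ≤ gr i
  fin : ∀ N : ℤ, {i | gr i ≤ N}.Finite
  ex : ∀ n : ℤ, 1 ≤ n → ∀ x, pj b gr n x = x → d x ∈ JS f k X → ∃ z, x - d z ∈ JS f k X

variable {f}
variable {X ι : Type} [AddCommGroup X] [Module Q X] {k c : ℕ} {b : Module.Basis ι Q X}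
    {gr : ι → ℤ} {d : Module.End Q X} {T : ℕ → Module.End Q X}

theorem Lev.sum_comm (h : Lev f k b gr d T) :
    ∑ i ∈ Finset.range k, f i • (d * T i - T i * d) = 0 := by
  have : d * (d * d) - (d * d) * d = 0 := by rw [mul_assoc, sub_self]
  rw [h.sq, Finset.mul_sum, Finset.sum_mul, ← Finset.sum_sub_distrib] at this
  rw [← this]
  refine Finset.sum_congr rfl fun i _ => ?_
  rw [smul_sub, mul_smul_comm, smul_mul_assoc]

theorem Lev.comm (h : Lev f k b gr d T) (hr : Reg f c) (hk : k ≤ c) :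
    ∀ i < k, OJ f b gr k (-3) (d * T i - T i * d) := by
  refine OJ_kz hr k hk _ (fun i _ => ?_) h.sum_comm
  exact ((h.hd.mul (h.hT i)).cast (by norm_num)).sub (((h.hT i).mul h.hd).cast (by norm_num))

theorem Lev.comm2 (h : Lev f k b gr d T) (hr : Reg f c) (hk : k ≤ c) :
    ∀ i < k, ∀ j < k, ∃ V, Hm b gr (-3) V ∧
      OJ f b gr k (-4) (T i * T j - T j * T i - (d * V + V * d)) := by
  intro i hi j hj
  obtain ⟨V, hV, hVe⟩ := h.comm hr hk j hj
  refine ⟨V i, hV i, ?_⟩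
  refine OJ_kz hr k hk (fun i => T i * T j - T j * T i - (d * V i + V i * d)) (fun i _ => ?_) ?_ i hi
  · refine Hm.sub (Hm.sub ?_ ?_) (Hm.add ?_ ?_)
    · exact ((h.hT i).mul (h.hT j)).cast (by norm_num)
    · exact ((h.hT j).mul (h.hT i)).cast (by norm_num)
    · exact (h.hd.mul (hV i)).cast (by norm_num)
    · exact ((hV i).mul h.hd).cast (by norm_num)
  · have e1 : (d * d) * T j - T j * (d * d) = d * (d * T j - T j * d) + (d * T j - T j * d) * d := by
      noncomm_ring
    rw [hVe, h.sq, Finset.mul_sum, Finset.sum_mul, Finset.mul_sum, Finset.sum_mul,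
      ← Finset.sum_sub_distrib, ← Finset.sum_add_distrib, ← sub_eq_zero, ← Finset.sum_sub_distrib]
      at e1
    rw [← e1]
    refine Finset.sum_congr rfl fun i _ => ?_
    simp only [smul_sub, smul_add, mul_smul_comm, smul_mul_assoc]

variable {W R : Type} [CommRing R] [AddCommGroup W] [Module Q W] [Module R W] [SMulCommClass Q R W]

theorem Lev.dT (h : Lev f k b gr d T) (hr : Reg f c) (hk : k ≤ c)
    (hf : ∀ i < c, ∀ w : W, f i • w = 0) {i : ℕ} (hi : i < k) (u : X →ₗ[Q] W) :
    (u ∘ₗ d) ∘ₗ T i = (u ∘ₗ T i) ∘ₗ d := by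
  have := OJ_comp (h.comm hr hk i hi) (fun i hi => hf i (by omega)) u
  rw [LinearMap.comp_sub, sub_eq_zero] at this
  exact this

theorem Lev.dd (h : Lev f k b gr d T) (hk : k ≤ c)
    (hf : ∀ i < c, ∀ w : W, f i • w = 0) (u : X →ₗ[Q] W) :
    (u ∘ₗ d) ∘ₗ d = 0 :=
  OJ_comp (a := d * d) (e := -2) ⟨T, h.hT, h.sq⟩ (fun i hi => hf i (by omega)) u

theorem Lev.Bc_le (h : Lev f k b gr d T) (hk : k ≤ c)
    (hf : ∀ i < c, ∀ w : W, f i • w = 0) : Bc W R b gr d ≤ Zc W R b gr d := by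
  rintro _ ⟨u, hu, rfl⟩
  exact ⟨Ef_comp h.hd hu, h.dd hk hf u⟩

theorem Lev.Bc_T (h : Lev f k b gr d T) (hr : Reg f c) (hk : k ≤ c)
    (hf : ∀ i < c, ∀ w : W, f i • w = 0) {i : ℕ} (hi : i < k) {u : X →ₗ[Q] W}
    (hu : u ∈ Bc W R b gr d) : u ∘ₗ T i ∈ Bc W R b gr d := by
  obtain ⟨u, hu, rfl⟩ := hu
  exact ⟨u ∘ₗ T i, Ef_comp (h.hT i) hu, (h.dT hr hk hf hi u).symm⟩

theorem Lev.Zc_T (h : Lev f k b gr d T) (hr : Reg f c) (hk : k ≤ c)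
    (hf : ∀ i < c, ∀ w : W, f i • w = 0) {i : ℕ} (hi : i < k) {u : X →ₗ[Q] W}
    (hu : u ∈ Zc W R b gr d) : u ∘ₗ T i ∈ Zc W R b gr d := by
  refine mem_Zc.2 ⟨Ef_comp (h.hT i) hu.1, ?_⟩
  rw [← h.dT hr hk hf hi, (mem_Zc.1 hu).2, LinearMap.zero_comp]

theorem Lev.TT (h : Lev f k b gr d T) (hr : Reg f c) (hk : k ≤ c)
    (hf : ∀ i < c, ∀ w : W, f i • w = 0) {i j : ℕ} (hi : i < k) (hj : j < k) {u : X →ₗ[Q] W}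
    (hu : u ∈ Zc W R b gr d) : (u ∘ₗ T i) ∘ₗ T j - (u ∘ₗ T j) ∘ₗ T i ∈ Bc W R b gr d := by
  obtain ⟨V, hV, hO⟩ := h.comm2 hr hk i hi j hj
  have := OJ_comp hO (fun i hi => hf i (by omega)) u
  refine mem_Bc.2 ⟨u ∘ₗ V, Ef_comp hV hu.1, ?_⟩
  rw [LinearMap.comp_sub, LinearMap.comp_sub, LinearMap.comp_add, sub_eq_zero] at this
  have h0 : u ∘ₗ (d * V) = 0 := by
    rw [Module.End.mul_eq_comp, ← LinearMap.comp_assoc, (mem_Zc.1 hu).2, LinearMap.zero_comp]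
  rw [h0, zero_add] at this
  exact this.symm

/-! cone -/

/-- grading of the cone -/
def cgr (gr : ι → ℤ) : ι ⊕ ι → ℤ := Sum.elim gr (fun i => gr i + 1)

/-- differential of the cone -/
def cd (r : Q) (d t : Module.End Q X) : Module.End Q (X × X) :=
  LinearMap.prod (d ∘ₗ LinearMap.fst Q X X + r • LinearMap.snd Q X X)
    (-(t ∘ₗ LinearMap.fst Q X X) - d ∘ₗ LinearMap.snd Q X X)

/-- operators of the cone -/
def cS (T V : Module.End Q X) : Module.End Q (X × X) :=
  LinearMap.prod (T ∘ₗ LinearMap.fst Q X X) (V ∘ₗ LinearMap.fst Q X X + T ∘ₗ LinearMap.snd Q X X)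

@[simp] theorem cd_apply (r : Q) (d t : Module.End Q X) (x y : X) :
    cd r d t (x, y) = (d x + r • y, -(t x) - d y) := rfl

@[simp] theorem cS_apply (T V : Module.End Q X) (x y : X) :
    cS T V (x, y) = (T x, V x + T y) := rfl

theorem pj_cone (b : Module.Basis ι Q X) (gr : ι → ℤ) (n : ℤ) :
    pj (b.prod b) (cgr gr) n = (pj b gr n).prodMap (pj b gr (n - 1)) := by
  refine (b.prod b).ext fun i => ?_
  rw [pj_b]
  rcases i with i | i
  · simp only [cgr, Sum.elim_inl, Module.Basis.prod_apply, LinearMap.coe_inl, Function.comp_apply,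
      LinearMap.prodMap_apply, map_zero, pj_b]
    split_ifs <;> rfl
  · simp only [cgr, Sum.elim_inr, Module.Basis.prod_apply, LinearMap.coe_inr, Function.comp_apply,
      LinearMap.prodMap_apply, map_zero, pj_b, eq_sub_iff_add_eq]
    split_ifs <;> rfl

theorem pj_cone_apply (b : Module.Basis ι Q X) (gr : ι → ℤ) (n : ℤ) (x y : X) :
    pj (b.prod b) (cgr gr) n (x, y) = (pj b gr n x, pj b gr (n - 1) y) := by
  rw [pj_cone]; rfl

theorem JS_prod {Y Y' : Type} [AddCommGroup Y] [Module Q Y] [AddCommGroup Y'] [Module Q Y'] {x : Y}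
    {y : Y'} : (x, y) ∈ JS f k (Y × Y') ↔ x ∈ JS f k Y ∧ y ∈ JS f k Y' := by
  constructor
  · intro h
    exact ⟨JS_map (LinearMap.fst Q Y Y') h, JS_map (LinearMap.snd Q Y Y') h⟩
  · rintro ⟨h, h'⟩
    have := add_mem (JS_map (LinearMap.inl Q Y Y') h) (JS_map (LinearMap.inr Q Y Y') h')
    simpa using this

theorem Hm.app {e : ℤ} {a : Module.End Q X} (h : Hm b gr e a) (n : ℤ) (x : X) :
    a (pj b gr n x) = pj b gr (n + e) (a x) := LinearMap.congr_fun (h n) x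

theorem Lev.cone (h : Lev f (k + 1) b gr d T) (hr : Reg f c) (hk : k + 1 ≤ c) :
    ∃ V : ℕ → Module.End Q X,
      Lev f k (b.prod b) (cgr gr) (cd (f k) d (T k)) (fun i => cS (T i) (V i)) := by
  obtain ⟨V, hV, hVe⟩ : OJ f b gr k (-3) (d * T k - T k * d) := by
    refine OJ_reg hr (by omega) ?_ (fun i => -(d * T i - T i * d)) ?_
    · exact ((h.hd.mul (h.hT k)).cast (by norm_num)).sub (((h.hT k).mul h.hd).cast (by norm_num))
    · have := h.sum_comm
      rw [Finset.sum_range_succ] at this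
      rw [eq_neg_of_add_eq_zero_right this]
      simp only [smul_neg, Finset.sum_neg_distrib]
  have hsq : ∀ x y, cd (f k) d (T k) (cd (f k) d (T k) (x, y)) =
      ∑ i ∈ Finset.range k, f i • cS (T i) (V i) (x, y) := by
    intro x y
    have e1 : ∀ x, d (d x) = ∑ i ∈ Finset.range k, f i • T i x + f k • T k x := by
      intro x
      have := LinearMap.congr_fun h.sq x
      rw [Finset.sum_range_succ] at this
      simpa [LinearMap.sum_apply] using this
    have e2 : d (T k x) - T k (d x) = ∑ i ∈ Finset.range k, f i • V i x := by
      have := LinearMap.congr_fun hVe x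
      simpa [LinearMap.sum_apply] using this
    refine Prod.ext ?_ ?_
    · simp only [cd_apply, cS_apply, Prod.fst_sum, Prod.smul_fst, map_add, map_smul, e1, smul_sub,
        smul_neg]
      abel
    · simp only [cd_apply, cS_apply, Prod.snd_sum, Prod.smul_snd, map_add, map_sub, map_neg,
        map_smul, e1, smul_add, Finset.sum_add_distrib, ← e2]
      abel
  refine ⟨V, ?_, ?_, ?_, ?_, ?_, ?_⟩
  · intro n
    refine LinearMap.ext fun ⟨x, y⟩ => ?_
    simp only [Module.End.mul_apply, pj_cone_apply, cd_apply, h.hd.app, (h.hT k).app, map_add,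
      map_sub, map_neg, map_smul, Int.reduceNeg]
    have e1 : n - 1 = n + -1 := by ring
    have e2 : n + -1 - 1 = n + -2 := by ring
    have e3 : n + -1 + -1 = n + -2 := by ring
    rw [e1, e2, e3]
  · intro i n
    refine LinearMap.ext fun ⟨x, y⟩ => ?_
    simp only [Module.End.mul_apply, pj_cone_apply, cS_apply, (hV i).app, (h.hT i).app, map_add]
    have e1 : n + -2 - 1 = n + -3 := by ring
    have e2 : n - 1 + -2 = n + -3 := by ring
    rw [e1, e2]
  · refine LinearMap.ext fun ⟨x, y⟩ => ?_
    rw [LinearMap.sum_apply]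
    exact hsq x y
  · rintro (i | i)
    · exact h.gr0 i
    · have := h.gr0 i
      simp only [cgr, Sum.elim_inr]; omega
  · intro N
    refine ((((h.fin N).image Sum.inl)).union ((h.fin N).image Sum.inr)).subset ?_
    rintro (i | i) hi
    · exact Or.inl ⟨i, hi, rfl⟩
    · refine Or.inr ⟨i, ?_, rfl⟩
      simp only [cgr, Set.mem_ofPred_eq, Sum.elim_inr] at hi ⊢; omega
  · rintro n hn ⟨x, y⟩ hp hJ
    rw [pj_cone_apply, Prod.mk.injEq] at hp
    have hJ0 := hJ
    rw [cd_apply, JS_prod] at hJ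
    obtain ⟨z, hz⟩ := h.ex n hn x hp.1 (mem_JS_succ.2 ⟨-y, by
      simpa using hJ.1⟩)
    obtain ⟨w, hw⟩ := mem_JS_succ.1 hz
    refine ⟨(z, w), ?_⟩
    have h1 : cd (f k) d (T k) ((x, y) - cd (f k) d (T k) (z, w)) ∈ JS f k (X × X) := by
      rw [map_sub]
      refine sub_mem hJ0 ?_
      rw [hsq]
      exact ⟨_, rfl⟩
    have hx' : x - (d z + f k • w) ∈ JS f k X := by rwa [← sub_sub]
    rw [cd_apply, Prod.mk_sub_mk] at h1 ⊢
    rw [cd_apply] at h1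
    have h2 := (JS_prod.1 h1).1
    have h3 := JS_map d hx'
    refine JS_prod.2 ⟨hx', hr.mod (by omega) b ?_⟩
    have := sub_mem h2 h3
    rwa [add_sub_cancel_left] at this

theorem main_gen [IsNoetherianRing R] [IsNoetherian R W] (hr : Reg f c)
    (hf : ∀ i < c, ∀ w : W, f i • w = 0)
    (hVan : ∀ (X ι : Type) [AddCommGroup X] [Module Q X] (b : Module.Basis ι Q X)
      (gr : ι → ℤ) (d : Module.End Q X) (T : ℕ → Module.End Q X), Lev f 0 b gr d T →
      ∃ D : ℤ, ∀ n > D, ∀ u : X →ₗ[Q] W, u ∘ₗ pj b gr n = u → u ∘ₗ d = 0 →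
        ∃ v : X →ₗ[Q] W, u = v ∘ₗ d) :
    ∀ (k : ℕ), k ≤ c → ∀ (X ι : Type) [AddCommGroup X] [Module Q X] (b : Module.Basis ι Q X)
      (gr : ι → ℤ) (d : Module.End Q X) (T : ℕ → Module.End Q X), Lev f k b gr d T →
      ∃ G : Set (X →ₗ[Q] W), G.Finite ∧ (∀ g ∈ G, g ∈ Zc W R b gr d) ∧
        ∀ U : Submodule R (X →ₗ[Q] W), Bc W R b gr d ≤ U → (∀ g ∈ G, g ∈ U) →
          (∀ i < k, ∀ u ∈ U, u ∘ₗ T i ∈ U) → Zc W R b gr d ≤ U := by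
  intro k
  induction k with
  | zero =>
    intro _ X ι _ _ b gr d T h
    obtain ⟨D, hD⟩ := hVan X ι b gr d T h
    let P : Submodule R (X →ₗ[Q] W) :=
      { carrier := {u | ∀ n > D, u ∘ₗ pj b gr n = 0}
        add_mem' := fun {u v} hu hv n hn => by rw [LinearMap.add_comp, hu n hn, hv n hn, add_zero]
        zero_mem' := fun n _ => by simp
        smul_mem' := fun r u hu n hn => by rw [LinearMap.smul_comp, hu n hn, smul_zero] }
    have hfin : Finite {i | gr i ≤ D} := h.fin D
    have hPN : IsNoetherian R P := by
      let ev : P →ₗ[R] ({i | gr i ≤ D} → W) :=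
        { toFun := fun u i => u.1 (b i.1)
          map_add' := fun u v => rfl
          map_smul' := fun r u => rfl }
      refine isNoetherian_of_injective ev ?_
      rintro ⟨u, hu⟩ ⟨v, hv⟩ huv
      refine Subtype.ext (b.ext fun i => ?_)
      by_cases hi : gr i ≤ D
      · exact congrFun huv ⟨i, hi⟩
      · have h1 := LinearMap.congr_fun (hu (gr i) (by omega)) (b i)
        have h2 := LinearMap.congr_fun (hv (gr i) (by omega)) (b i)
        simp only [LinearMap.comp_apply, pj_b, if_true, LinearMap.zero_apply] at h1 h2
        exact h1.trans h2.symm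
    obtain ⟨G, hG⟩ := isNoetherian_submodule.1 hPN (P ⊓ Zc W R b gr d) inf_le_left
    refine ⟨G, G.finite_toSet, fun g hg => ?_, ?_⟩
    · have : g ∈ P ⊓ Zc W R b gr d := by rw [← hG]; exact Submodule.subset_span hg
      exact this.2
    · intro U hBU hGU _ z hz
      refine Ef_mem_of h.gr0 hz.1 U fun n => ?_
      by_cases hn : D < n
      · obtain ⟨v, hv⟩ := hD n hn (z ∘ₗ pj b gr n) (comp_pj_self z n)
          (mem_Zc.1 (Zc_pj h.hd hz n)).2
        refine hBU (mem_Bc.2 ⟨v ∘ₗ pj b gr (n + -1), Ef_pj v _, ?_⟩)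
        rw [← h.hd.comp, ← hv, comp_pj_self]
      · have : P ⊓ Zc W R b gr d ≤ U := by
          rw [← hG]; exact Submodule.span_le.2 hGU
        refine this ⟨fun m hm => comp_pj_ne z (by omega), Zc_pj h.hd hz n⟩
  | succ k ih =>
    intro hk X ι _ _ b gr d T h
    obtain ⟨V, hL⟩ := h.cone hr hk
    have hk' : k ≤ c := by omega
    obtain ⟨G1, hG1, hG1Z, hG1gen⟩ := ih hk' (X × X) (ι ⊕ ι) _ _ _ _ hL
    let io : (X →ₗ[Q] W) →ₗ[R] (X × X →ₗ[Q] W) :=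
      { toFun := fun u => u ∘ₗ LinearMap.fst Q X X
        map_add' := fun u v => rfl
        map_smul' := fun r u => rfl }
    have hio : ∀ u x y, io u (x, y) = u x := fun u x y => rfl
    have hioS : ∀ u i, io u ∘ₗ cS (T i) (V i) = io (u ∘ₗ T i) := fun u i => rfl
    have hioZ : ∀ u ∈ Zc W R b gr d, io u ∈ Zc W R (b.prod b) (cgr gr) (cd (f k) d (T k)) := by
      intro u hu
      obtain ⟨⟨N, hN⟩, hud⟩ := mem_Zc.1 hu
      refine mem_Zc.2 ⟨⟨N, fun n hn => ?_⟩, ?_⟩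
      · refine LinearMap.ext fun ⟨x, y⟩ => ?_
        rw [LinearMap.comp_apply, pj_cone_apply, hio]
        exact LinearMap.congr_fun (hN n hn) x
      · refine LinearMap.ext fun ⟨x, y⟩ => ?_
        rw [LinearMap.comp_apply, cd_apply, hio, map_add, map_smul, hf k (by omega), add_zero]
        exact LinearMap.congr_fun hud x
    set BL := Bc W R (b.prod b) (cgr gr) (cd (f k) d (T k)) with hBL
    set ZL := Zc W R (b.prod b) (cgr gr) (cd (f k) d (T k)) with hZL
    obtain ⟨G', hG', hG'V, hgen⟩ := al_main BL ZL (hL.Bc_le hk' hf) k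
      (fun i => pre W R (cS (T i) (V i)))
      (fun i hi x hx => hL.Bc_T hr hk' hf hi hx)
      (fun i hi x hx => hL.Zc_T hr hk' hf hi hx)
      (fun i hi j hj z hz => hL.TT hr hk' hf hj hi hz)
      G1 hG1 hG1Z hG1gen ((Zc W R b gr d).map io ⊔ BL) le_sup_right
      (sup_le (Submodule.map_le_iff_le_comap.2 hioZ) (hL.Bc_le hk' hf))
      (by
        intro i hi x hx
        obtain ⟨_, ⟨u, hu, rfl⟩, β, hβ, rfl⟩ := Submodule.mem_sup.1 hx
        rw [map_add]
        refine add_mem (Submodule.mem_sup_left ⟨u ∘ₗ T i, h.Zc_T hr hk hf (by omega) hu, rfl⟩)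
          (Submodule.mem_sup_right (hL.Bc_T hr hk' hf hi hβ)))
    have hdec : ∀ g : G', ∃ u ∈ Zc W R b gr d, ∃ β ∈ BL, io u + β = g.1 := by
      intro g
      obtain ⟨_, ⟨u, hu, rfl⟩, β, hβ, he⟩ := Submodule.mem_sup.1 (hG'V g.1 g.2)
      exact ⟨u, hu, β, hβ, he⟩
    choose ug hug βg hβg heg using hdec
    have : Finite G' := hG'
    refine ⟨⋃ g : G', Set.range fun n : ℤ => ug g ∘ₗ pj b gr n, ?_, ?_, ?_⟩
    · refine Set.finite_iUnion fun g => ?_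
      obtain ⟨N, hN⟩ := (hug g).1
      refine (((Set.finite_Icc (0 : ℤ) N).image fun n : ℤ => ug g ∘ₗ pj b gr n).union
        (Set.finite_singleton 0)).subset ?_
      rintro _ ⟨n, rfl⟩
      by_cases h1 : n < 0
      · right; simp [pj_neg h.gr0 h1]
      by_cases h2 : N < n
      · right; exact hN n h2
      · left; exact ⟨n, ⟨by omega, by omega⟩, rfl⟩
    · intro g hg
      obtain ⟨g', n, rfl⟩ := Set.mem_iUnion.1 hg
      exact Zc_pj h.hd (hug g') n
    · intro U hBU hGU hUT z hz
      let U' : Submodule R (X →ₗ[Q] W) :=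
        { carrier := {u | ∀ n, u ∘ₗ pj b gr n ∈ U}
          add_mem' := fun {u v} hu hv n => by rw [LinearMap.add_comp]; exact add_mem (hu n) (hv n)
          zero_mem' := fun n => by simp
          smul_mem' := fun r u hu n => by rw [LinearMap.smul_comp]; exact U.smul_mem _ (hu n) }
      have hle : (Zc W R b gr d).map io ⊔ BL ≤ U'.map io ⊔ BL := by
        refine hgen _ le_sup_right ?_ ?_
        · intro g hg
          rw [show g = _ from (heg ⟨g, hg⟩).symm]
          refine add_mem (Submodule.mem_sup_left ⟨_, fun n => ?_, rfl⟩)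
            (Submodule.mem_sup_right (hβg _))
          exact hGU _ (Set.mem_iUnion.2 ⟨_, n, rfl⟩)
        · intro i hi x hx
          obtain ⟨_, ⟨u, hu, rfl⟩, β, hβ, rfl⟩ := Submodule.mem_sup.1 hx
          rw [map_add]
          refine add_mem (Submodule.mem_sup_left ⟨u ∘ₗ T i, fun n => ?_, rfl⟩)
            (Submodule.mem_sup_right (hL.Bc_T hr hk' hf hi hβ))
          rw [(h.hT i).comp]
          exact hUT i (by omega) _ (hu _)
      have key : ∀ z ∈ Zc W R b gr d, ∃ u ∈ U', ∃ h1 : X →ₗ[Q] W, ∃ h2 ∈ Zc W R b gr d,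
          z = u + h1 ∘ₗ d - h2 ∘ₗ T k := by
        intro z hz
        obtain ⟨_, ⟨u, hu, rfl⟩, β, ⟨q, ⟨N, hN⟩, rfl⟩, he⟩ := Submodule.mem_sup.1
          (hle (Submodule.mem_sup_left ⟨z, hz, rfl⟩))
        have hq : ∀ x y, z x = u x + (q (d x, 0) + f k • q (y, 0) - q (0, T k x) - q (0, d y)) := by
          intro x y
          have := LinearMap.congr_fun he (x, y)
          rw [LinearMap.add_apply, hio, hio, pre_apply, LinearMap.comp_apply, cd_apply] at this
          rw [← this]
          congr 1
          rw [← map_smul, ← map_add, ← map_sub, ← map_sub]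
          congr 1
          simp
        refine ⟨u, hu, q ∘ₗ LinearMap.inl Q X X, q ∘ₗ LinearMap.inr Q X X, ?_, ?_⟩
        · refine mem_Zc.2 ⟨⟨N, fun n hn => ?_⟩, ?_⟩
          · refine LinearMap.ext fun x => ?_
            have := LinearMap.congr_fun (hN (n + 1) (by omega)) (0, x)
            rw [LinearMap.comp_apply, pj_cone_apply, map_zero, add_sub_cancel_right] at this
            exact this
          · refine LinearMap.ext fun x => ?_
            have h1 := hq 0 x
            rw [hf k (by omega)] at h1
            have h00 : q (0, 0) = 0 := map_zero q
            simp only [map_zero, h00, zero_add, sub_zero, zero_sub] at h1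
            simp only [LinearMap.comp_apply, LinearMap.inr_apply, LinearMap.zero_apply]
            exact neg_eq_zero.1 h1.symm
        · refine LinearMap.ext fun x => ?_
          have h1 := hq x 0
          have h00 : q (0, 0) = 0 := map_zero q
          simp only [map_zero, h00, smul_zero, add_zero, sub_zero] at h1
          rw [h1, add_sub_assoc]
          rfl
      have fin : ∀ m : ℕ, ∀ n : ℤ, n < m → ∀ z ∈ Zc W R b gr d, z ∘ₗ pj b gr n ∈ U := by
        intro m
        induction m with
        | zero =>
          intro n hn z hz
          rw [pj_neg h.gr0 (by simpa using hn), LinearMap.comp_zero]; exact zero_mem _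
        | succ m ihm =>
          intro n hn z hz
          obtain ⟨u, hu, h1, h2, hh2, rfl⟩ := key z hz
          rw [LinearMap.sub_comp, LinearMap.add_comp, h.hd.comp, (h.hT k).comp]
          refine sub_mem (add_mem (hu n) (hBU (mem_Bc.2 ⟨_, Ef_pj _ _, rfl⟩)))
            (hUT k (by omega) _ (ihm _ (by push_cast at hn; omega) _ hh2))
      exact Ef_mem_of h.gr0 hz.1 U fun n => fin (n.toNat + 1) n (by push_cast; omega) z hz

end Levels

end CxProof


namespace CxProof

open IsLocalRing

section RegLoc

theorem JS_quot {Q : Type} [CommRing Q] (x : Q) (g' : ℕ → Q ⧸ Ideal.span {x}) (g : ℕ → Q)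
    (h0 : g 0 = x) (hs : ∀ i, Ideal.Quotient.mk (Ideal.span {x}) (g (i + 1)) = g' i) (k : ℕ) (y : Q) :
    y ∈ JS g (k + 1) Q ↔ Ideal.Quotient.mk (Ideal.span {x}) y ∈ JS g' k (Q ⧸ Ideal.span {x}) := by
  constructor
  · rintro ⟨c, rfl⟩
    refine ⟨fun i => Ideal.Quotient.mk _ (c (i + 1)), ?_⟩
    rw [Finset.sum_range_succ', map_add, map_sum, h0]
    have : Ideal.Quotient.mk (Ideal.span {x}) (x • c 0) = 0 := by
      rw [Ideal.Quotient.eq_zero_iff_mem, Ideal.mem_span_singleton]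
      exact ⟨c 0, rfl⟩
    rw [this, add_zero]
    refine Finset.sum_congr rfl fun i _ => ?_
    rw [smul_eq_mul, map_mul, hs, smul_eq_mul]
  · rintro ⟨c', hc⟩
    choose c hcc using fun i => Ideal.Quotient.mk_surjective (c' i)
    have : y - ∑ i ∈ Finset.range k, g (i + 1) * c i ∈ Ideal.span {x} := by
      rw [← Ideal.Quotient.eq_zero_iff_mem, map_sub, hc, map_sum, sub_eq_zero]
      refine Finset.sum_congr rfl fun i _ => ?_
      rw [map_mul, hs, hcc, smul_eq_mul]
    obtain ⟨t, ht⟩ := Ideal.mem_span_singleton.1 this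
    refine ⟨fun i => if i = 0 then t else c (i - 1), ?_⟩
    rw [Finset.sum_range_succ']
    simp only [if_true, h0, smul_eq_mul, ← ht, Nat.add_eq_zero_iff, one_ne_zero, and_false, if_false,
      Nat.add_sub_cancel]
    ring

theorem reg_local : ∀ (d : ℕ) (Q : Type) [CommRing Q] [IsLocalRing Q] [IsNoetherianRing Q]
    (s : Fin d → Q), Ideal.span (Set.range s) = maximalIdeal Q → ringKrullDim Q = d →
    IsDomain Q ∧ ∃ g : ℕ → Q, Reg g d ∧ ∀ x, x ∈ maximalIdeal Q ↔ x ∈ JS g d Q := by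
  intro d
  induction d with
  | zero =>
    intro Q _ _ _ s hs hd
    have hm : maximalIdeal Q = ⊥ := by rw [← hs]; simp
    have hF : IsField Q := IsLocalRing.isField_iff_maximalIdeal_eq.2 hm
    refine ⟨hF.isDomain, fun _ => 0, fun k hk => by omega, fun x => ?_⟩
    rw [hm, JS_zero]
  | succ d ih =>
    intro Q _ _ _ s hs hd
    have hNP : ¬ maximalIdeal Q ≤ maximalIdeal Q ^ 2 := by
      intro h
      have hm : maximalIdeal Q = ⊥ := by
        refine Submodule.eq_bot_of_le_smul_of_le_jacobson_bot (maximalIdeal Q) _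
          (IsNoetherian.noetherian _) ?_ (IsLocalRing.jacobson_eq_maximalIdeal ⊥ bot_ne_top).ge
        rw [smul_eq_mul, ← pow_two]; exact h
      have hF : IsField Q := IsLocalRing.isField_iff_maximalIdeal_eq.2 hm
      have := ringKrullDim_eq_zero_of_isField hF
      rw [this] at hd
      norm_cast at hd
    have hht : ∀ p ∈ minimalPrimes Q, ¬ maximalIdeal Q ≤ p := by
      intro p hp h
      have hp1 : p.IsPrime := hp.1.1
      have : p = maximalIdeal Q := le_antisymm (IsLocalRing.le_maximalIdeal hp1.ne_top) h
      rw [this, ← Ideal.height_eq_zero_iff] at hp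
      rw [← IsLocalRing.maximalIdeal_height_eq_ringKrullDim, hp] at hd
      norm_cast at hd
    obtain ⟨x, hxm, hx2, hxp⟩ : ∃ x ∈ maximalIdeal Q, x ∉ maximalIdeal Q ^ 2 ∧
        ∀ p ∈ minimalPrimes Q, x ∉ p := by
      by_contra hcon
      push Not at hcon
      have hfin : (insert (maximalIdeal Q ^ 2) (minimalPrimes Q)).Finite :=
        (minimalPrimes.finite_of_isNoetherianRing Q).insert _
      have := (Ideal.subset_union_prime_finite hfin (f := id) (maximalIdeal Q ^ 2)
        (maximalIdeal Q ^ 2) (fun p hp h1 _ => by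
          rcases hp with hp | hp
          · exact absurd hp h1
          · exact hp.1.1) (I := maximalIdeal Q)).1 (by
        intro x hx
        by_cases h2 : x ∈ maximalIdeal Q ^ 2
        · exact Set.mem_biUnion (Set.mem_insert _ _) h2
        · obtain ⟨p, hp, hxp⟩ := hcon x hx h2
          exact Set.mem_biUnion (Set.mem_insert_of_mem _ hp) hxp)
      obtain ⟨p, hp, hle⟩ := this
      rcases hp with rfl | hp
      · exact hNP hle
      · exact hht p hp hle
    have hsm : ∀ i, s i ∈ maximalIdeal Q := fun i => by
      rw [← hs]; exact Ideal.subset_span ⟨i, rfl⟩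
    obtain ⟨a, ha⟩ : ∃ a : Fin (d + 1) → Q, ∑ i, a i * s i = x := by
      have h1 : x ∈ Ideal.span (Set.range s) := by rw [hs]; exact hxm
      exact (Ideal.mem_span_range_iff_exists_fun).1 h1
    obtain ⟨i, hi⟩ : ∃ i, IsUnit (a i) := by
      by_contra hcon
      push Not at hcon
      refine hx2 ?_
      rw [← ha, pow_two]
      exact Ideal.sum_mem _ fun i _ => Ideal.mul_mem_mul ((mem_maximalIdeal _).2 (hcon i)) (hsm i)
    let mk := Ideal.Quotient.mk (Ideal.span {x})
    have hne : Ideal.span {x} ≠ ⊤ := by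
      intro h
      rw [Ideal.span_singleton_eq_top] at h
      exact (mem_maximalIdeal _).1 hxm h
    have : Nontrivial (Q ⧸ Ideal.span {x}) := Ideal.Quotient.nontrivial_iff.2 hne
    have hloc : IsLocalRing (Q ⧸ Ideal.span {x}) :=
      IsLocalRing.of_surjective' mk Ideal.Quotient.mk_surjective
    have hmx : mk x = 0 := by
      rw [Ideal.Quotient.eq_zero_iff_mem]; exact Ideal.mem_span_singleton_self x
    have hmap : (maximalIdeal Q).map mk = maximalIdeal (Q ⧸ Ideal.span {x}) :=
      IsLocalRing.map_maximalIdeal_of_surjective mk Ideal.Quotient.mk_surjective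
    have hs' : Ideal.span (Set.range fun j : Fin d => mk (s (i.succAbove j))) =
        maximalIdeal (Q ⧸ Ideal.span {x}) := by
      apply le_antisymm
      · rw [Ideal.span_le]
        rintro _ ⟨j, rfl⟩
        rw [← hmap]
        exact Ideal.mem_map_of_mem _ (hsm _)
      · rw [← hmap, ← hs, Ideal.map_span, Ideal.span_le]
        rintro _ ⟨_, ⟨j, rfl⟩, rfl⟩
        rcases Fin.eq_self_or_eq_succAbove i j with rfl | ⟨l, rfl⟩
        · have h1 : mk (a j) * mk (s j) = - ∑ l, mk (a (j.succAbove l)) * mk (s (j.succAbove l)) := by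
            have := congrArg mk ha
            rw [hmx, Fin.sum_univ_succAbove _ j, map_add, map_mul, map_sum] at this
            simp only [map_mul] at this
            exact eq_neg_of_add_eq_zero_left this
          obtain ⟨u, hu⟩ := hi.map mk
          have h2 : mk (s j) = ↑u⁻¹ * (mk (a j) * mk (s j)) := by
            rw [← hu, Units.inv_mul_cancel_left]
          show mk (s j) ∈ _
          rw [h2, h1]
          refine Ideal.mul_mem_left _ _ (neg_mem (Ideal.sum_mem _ fun l _ => ?_))
          exact Ideal.mul_mem_left _ _ (Ideal.subset_span ⟨l, rfl⟩)
        · exact Ideal.subset_span ⟨l, rfl⟩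
    have hdim : ringKrullDim (Q ⧸ Ideal.span {x}) = d := by
      apply le_antisymm
      · refine (ringKrullDim_le_spanFinrank_maximalIdeal _).trans ?_
        rw [← hs']
        have := Submodule.spanFinrank_span_le_ncard_of_finite (R := Q ⧸ Ideal.span {x})
          (Set.finite_range fun j : Fin d => mk (s (i.succAbove j)))
        have h2 : (Set.range fun j : Fin d => mk (s (i.succAbove j))).ncard ≤ d := by
          rw [← Set.image_univ]
          refine (Set.ncard_image_le Set.finite_univ).trans ?_
          rw [Set.ncard_univ, Nat.card_eq_fintype_card, Fintype.card_fin]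
        have h3 := this.trans h2
        exact_mod_cast h3
      · have h1 := ringKrullDim_le_ringKrullDim_quotient_add_card (R := Q) {x} (by
          simp only [Finset.coe_singleton, Set.singleton_subset_iff]
          rw [IsLocalRing.ringJacobson_eq_maximalIdeal]; exact hxm)
        have he : Ideal.span ((({x} : Finset Q) : Set Q)) = Ideal.span {x} := by simp
        rw [hd, ringKrullDim_eq_of_ringEquiv (Ideal.quotEquivOfEq he)] at h1
        simp only [Finset.card_singleton] at h1
        have h2 : ((d : WithBot ℕ∞) + 1) ≤ ringKrullDim (Q ⧸ Ideal.span {x}) + 1 := by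
          exact_mod_cast h1
        exact ENat.WithBot.add_le_add_one_right_iff.1 h2
    obtain ⟨hdom, g', hg', hgm'⟩ := ih (Q ⧸ Ideal.span {x}) _ hs' hdim
    have hprime : (Ideal.span {x}).IsPrime := (Ideal.Quotient.isDomain_iff_prime _).1 hdom
    obtain ⟨p, hp, hpx⟩ := Ideal.exists_minimalPrimes_le (I := ⊥) (J := Ideal.span {x}) bot_le
    have hpp : p.IsPrime := hp.1.1
    have hpb : p = ⊥ := by
      refine Submodule.eq_bot_of_le_smul_of_le_jacobson_bot (maximalIdeal Q) _
          (IsNoetherian.noetherian _) ?_ (IsLocalRing.jacobson_eq_maximalIdeal ⊥ bot_ne_top).ge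
      intro y hy
      obtain ⟨t, rfl⟩ := Ideal.mem_span_singleton.1 (hpx hy)
      have ht : t ∈ p := (hpp.mem_or_mem hy).resolve_left (hxp p hp)
      exact Ideal.mul_mem_mul hxm ht
    have hdomQ : IsDomain Q := by
      rw [hpb] at hpp
      exact IsDomain.of_bot_isPrime Q
    refine ⟨hdomQ, ?_⟩
    choose gl hgl using fun i => Ideal.Quotient.mk_surjective (g' i)
    let g : ℕ → Q := fun i => if i = 0 then x else gl (i - 1)
    have key := JS_quot x g' g rfl (fun i => hgl i)
    refine ⟨g, ?_, ?_⟩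
    · intro k hk y hy
      rcases k with _ | k
      · rw [JS_zero, Submodule.mem_bot] at hy ⊢
        refine (mul_eq_zero.1 hy).resolve_left fun h => ?_
        exact hxp p hp (by
          have : x = 0 := h
          rw [this]; exact zero_mem _)
      · rw [key] at hy ⊢
        refine hg' k (by omega) _ ?_
        rw [map_mul] at hy
        have : Ideal.Quotient.mk (Ideal.span {x}) (g (k + 1)) = g' k := hgl k
        rwa [this] at hy
    · intro y
      rw [key, ← hgm']
      constructor
      · intro h
        rw [← hmap]; exact Ideal.mem_map_of_mem _ h
      · intro h
        rw [mem_maximalIdeal, mem_nonunits_iff] at h ⊢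
        exact fun hu => h (hu.map mk)

end RegLoc

section Vanish

variable {Q : Type} [CommRing Q] {f g : ℕ → Q} {X ι : Type} [AddCommGroup X] [Module Q X]
    {b : Module.Basis ι Q X} {gr : ι → ℤ} {d : Module.End Q X} {T : ℕ → Module.End Q X}

theorem pj_pj (n : ℤ) (x : X) : pj b gr n (pj b gr n x) = pj b gr n x := by
  rw [← Module.End.mul_apply, pj_mul_self]

theorem one_tmul_surj [IsLocalRing Q] {Y : Type} [AddCommGroup Y] [Module Q Y]
    (t : TensorProduct Q (ResidueField Q) Y) :
    ∃ p : Y, t = TensorProduct.tmul Q (1 : ResidueField Q) p := by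
  induction t using TensorProduct.induction_on with
  | zero => exact ⟨0, by simp⟩
  | tmul r p =>
    obtain ⟨q, rfl⟩ := IsLocalRing.residue_surjective r
    refine ⟨q • p, ?_⟩
    rw [← TensorProduct.smul_tmul]
    congr 1
    rw [Algebra.smul_def, mul_one]; rfl
  | add x y hx hy =>
    obtain ⟨p, rfl⟩ := hx
    obtain ⟨q, rfl⟩ := hy
    exact ⟨p + q, by rw [TensorProduct.tmul_add]⟩

theorem van_ex (h : Lev f 0 b gr d T) {D : ℕ} (hg : Reg g D) : ∀ i : ℕ, i ≤ D → ∀ n : ℤ, i + 1 ≤ n →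
    ∀ x, pj b gr n x = x → d x ∈ JS g i X → ∃ z, x - d z ∈ JS g i X := by
  have hdd : ∀ x, d (d x) = 0 := by
    intro x
    have := LinearMap.congr_fun h.sq x
    simpa using this
  intro i
  induction i with
  | zero =>
    intro _ n hn x hx hJ
    have := h.ex n (by simpa using hn) x hx (by rwa [JS_zero] at hJ ⊢)
    rwa [JS_zero] at this ⊢
  | succ i ih =>
    intro hi n hn x hx hJ
    push_cast at hn
    obtain ⟨y, hy⟩ := mem_JS_succ.1 hJ
    have hpx : pj b gr (n + -1) (d x) = d x := by rw [← h.hd.app, hx]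
    have hy1 := JS_map (pj b gr (n + -1)) hy
    rw [map_sub, map_smul, hpx] at hy1
    obtain ⟨y', hy'⟩ : ∃ y', y' = pj b gr (n + -1) y := ⟨_, rfl⟩
    have hy'' : pj b gr (n + -1) y' = y' := by rw [hy', pj_pj]
    rw [← hy'] at hy1
    have h1 := JS_map d hy1
    rw [map_sub, hdd, zero_sub, map_smul] at h1
    have h2 := hg.mod (by omega) b ((neg_mem_iff).1 h1)
    obtain ⟨w, hw⟩ := ih (by omega) (n + -1) (by omega) y' hy'' h2
    have hw1 := JS_map (pj b gr (n + -1)) hw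
    rw [map_sub, hy'', ← h.hd.app] at hw1
    obtain ⟨w', hw'⟩ : ∃ w', w' = pj b gr n w := ⟨_, rfl⟩
    have hw'' : pj b gr n w' = w' := by rw [hw', pj_pj]
    rw [← hw'] at hw1
    obtain ⟨z, hz⟩ := ih (by omega) n (by omega) (x - g i • w') (by rw [map_sub, map_smul, hx, hw''])
      (by
        have := add_mem hy1 (Submodule.smul_mem _ (g i) hw1)
        rw [smul_sub, sub_add_sub_cancel] at this
        rwa [map_sub, map_smul])
    refine ⟨z, mem_JS_succ.2 ⟨w', ?_⟩⟩
    rwa [sub_right_comm]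

theorem van [IsLocalRing Q] (h : Lev f 0 b gr d T) {D : ℕ} (hg : Reg g D)
    (hgm : ∀ x, x ∈ maximalIdeal Q ↔ x ∈ JS g D Q) (W : Type) [AddCommGroup W] [Module Q W] :
    ∃ D : ℤ, ∀ n > D, ∀ u : X →ₗ[Q] W, u ∘ₗ pj b gr n = u → u ∘ₗ d = 0 →
        ∃ v : X →ₗ[Q] W, u = v ∘ₗ d := by
  have hdd : ∀ x, d (d x) = 0 := by
    intro x
    have := LinearMap.congr_fun h.sq x
    simpa using this
  refine ⟨D, fun n hn u hu hud => ?_⟩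
  have hud' : ∀ x, u (d x) = 0 := fun x => LinearMap.congr_fun hud x
  have hup : ∀ x, u (pj b gr n x) = u x := fun x => LinearMap.congr_fun hu x
  have hpp : ∀ x, pj b gr n (pj b gr n x) = pj b gr n x :=
    fun x => pj_pj n x
  let Xn : Submodule Q X := LinearMap.range (pj b gr n)
  have hXn : ∀ x : Xn, pj b gr n x.1 = x.1 := by
    rintro ⟨_, x, rfl⟩
    exact hpp x
  let dn : Xn →ₗ[Q] X := d ∘ₗ Xn.subtype
  let P := LinearMap.range dn
  have hfX : Module.Finite Q Xn := by
    refine ⟨(Submodule.fg_top _).2 ?_⟩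
    have : Xn = Submodule.span Q (Set.range fun i => pj b gr n (b i)) := by
      have h1 : Xn = (⊤ : Submodule Q X).map (pj b gr n) := (Submodule.map_top _).symm
      rw [h1, ← b.span_eq, Submodule.map_span, ← Set.range_comp]
      rfl
    rw [this]
    refine Submodule.fg_span ?_
    refine (((h.fin n).image b).union (Set.finite_singleton 0)).subset ?_
    rintro _ ⟨i, rfl⟩
    simp only [pj_b]
    split_ifs with hi
    · exact Or.inl ⟨i, hi.le, rfl⟩
    · exact Or.inr rfl
  have hfP : Module.Finite Q P := Module.Finite.range dn
  have hfin : Finite {i | gr i ≤ n + -1} := h.fin _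
  let φ : X →ₗ[Q] ({i | gr i ≤ n + -1} → Q) :=
    LinearMap.pi fun i => Finsupp.lapply i.1 ∘ₗ b.repr.toLinearMap ∘ₗ pj b gr (n + -1)
  have hφ : ∀ x i, φ x i = b.repr (pj b gr (n + -1) x) i.1 := fun x i => rfl
  obtain ⟨l', hl'⟩ := (IsLocalRing.split_injective_iff_lTensor_residueField_injective
    (φ ∘ₗ P.subtype)).2 (by
      rw [injective_iff_map_eq_zero]
      intro t ht
      obtain ⟨⟨_, x, rfl⟩, rfl⟩ := one_tmul_surj t
      rw [LinearMap.lTensor_tmul] at ht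
      have hxm : dn x ∈ JS g D X := by
        rw [JS_repr b]
        intro i
        have hdx : dn x = pj b gr (n + -1) (dn x) := by
          show d x.1 = _
          conv_lhs => rw [← hXn x, h.hd.app]
          rfl
        rw [hdx]
        by_cases hi : gr i ≤ n + -1
        · rw [← hgm]
          have h1 := congrArg (LinearMap.lTensor (ResidueField Q)
            (LinearMap.proj (R := Q) (φ := fun _ => Q) (⟨i, hi⟩ : {i | gr i ≤ n + -1}))) ht
          rw [LinearMap.lTensor_tmul, map_zero] at h1
          have h2 := congrArg (TensorProduct.rid Q (ResidueField Q)) h1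
          rw [TensorProduct.rid_tmul, map_zero] at h2
          rw [Algebra.smul_def, mul_one] at h2
          exact (IsLocalRing.residue_eq_zero_iff _).1 h2
        · rw [repr_pj, if_neg (by omega)]; exact zero_mem _
      obtain ⟨z, c, hc⟩ := van_ex h hg D le_rfl n (by omega) x.1 (hXn x) hxm
      have h3 : dn x = ∑ i ∈ Finset.range D, g i • d (pj b gr n (c i)) := by
        have := congrArg (fun y => pj b gr (n + -1) (d y)) hc
        simp only [map_sub, hdd, sub_zero, map_sum, map_smul, ← h.hd.app] at this
        rw [hXn] at this
        exact this
      have h4 : (⟨dn x, LinearMap.mem_range_self dn x⟩ : P) =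
          ∑ i ∈ Finset.range D, g i • (⟨d (pj b gr n (c i)), ⟨⟨_, ⟨c i, rfl⟩⟩, rfl⟩⟩ : P) := by
        refine Subtype.ext ?_
        rw [Submodule.coe_sum]
        exact h3
      rw [h4, TensorProduct.tmul_sum]
      refine Finset.sum_eq_zero fun i hi => ?_
      rw [← TensorProduct.smul_tmul, Algebra.smul_def, mul_one]
      have : algebraMap Q (ResidueField Q) (g i) = 0 := by
        refine (IsLocalRing.residue_eq_zero_iff _).2 ?_
        rw [hgm]
        refine ⟨fun j => if j = i then 1 else 0, ?_⟩
        simp [Finset.mem_range.1 hi]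
      rw [this, TensorProduct.zero_tmul])
  have hker : LinearMap.ker dn ≤ LinearMap.ker (u ∘ₗ Xn.subtype) := by
    intro x hx
    have hx0 : d x.1 = 0 := hx
    obtain ⟨z, hz⟩ := h.ex n (by omega) x.1 (hXn x) (by rw [hx0]; exact zero_mem _)
    rw [JS_zero, Submodule.mem_bot, sub_eq_zero] at hz
    rw [LinearMap.mem_ker, LinearMap.comp_apply, Submodule.subtype_apply, hz, hud']
  let ub : P →ₗ[Q] W := (LinearMap.ker dn).liftQ (u ∘ₗ Xn.subtype) hker ∘ₗ
    dn.quotKerEquivRange.symm.toLinearMap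
  have hub : ∀ x : Xn, ub ⟨dn x, LinearMap.mem_range_self dn x⟩ = u x.1 := by
    intro x
    have : dn.quotKerEquivRange.symm ⟨dn x, LinearMap.mem_range_self dn x⟩ =
        (LinearMap.ker dn).mkQ x := by
      rw [LinearEquiv.symm_apply_eq]; rfl
    simp only [ub, LinearMap.comp_apply, LinearEquiv.coe_coe, this]
    rfl
  refine ⟨ub ∘ₗ l' ∘ₗ φ, LinearMap.ext fun x => ?_⟩
  have e1 : φ (d x) = φ (d (pj b gr n x)) := by
    funext i
    rw [hφ, hφ, ← h.hd.app, ← h.hd.app, pj_pj]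
  have e2 := hub ⟨pj b gr n x, x, rfl⟩
  have e3 := LinearMap.congr_fun hl' ⟨dn ⟨pj b gr n x, x, rfl⟩, LinearMap.mem_range_self dn _⟩
  simp only [LinearMap.comp_apply, LinearMap.id_apply, Submodule.subtype_apply] at e3 ⊢
  rw [e1, ← hup x, ← e2, ← e3]
  rfl

end Vanish

end CxProof


namespace CxProof

section ExtCompute

open CategoryTheory

variable {A : Type} [CommRing A]

theorem sc_homology (S : ShortComplex (ModuleCat.{0} A)) :
    ∃ q : LinearMap.ker S.g.hom →ₗ[A] S.homology, Function.Surjective q ∧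
      ∀ z, q z = 0 ↔ ∃ v, S.f.hom v = z.1 := by
  let e : (LinearMap.ker S.g.hom ⧸ LinearMap.range S.moduleCatToCycles) ≃ₗ[A] S.homology :=
    S.moduleCatHomologyIso.toLinearEquiv.symm
  refine ⟨e.toLinearMap ∘ₗ (LinearMap.range S.moduleCatToCycles).mkQ,
    e.surjective.comp (Submodule.mkQ_surjective _), fun z => ?_⟩
  refine (LinearEquiv.map_eq_zero_iff e).trans ((Submodule.Quotient.mk_eq_zero _).trans ?_)
  constructor
  · rintro ⟨v, hv⟩; exact ⟨v, congrArg Subtype.val hv⟩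
  · rintro ⟨v, hv⟩; exact ⟨v, Subtype.ext hv⟩

theorem ext_res {M Y : ModuleCat.{0} A} (P : ProjectiveResolution M) (n : ℕ) :
    ∃ q : LinearMap.ker (Linear.leftComp A Y (P.complex.d (n + 2) (n + 1))) →ₗ[A]
        ((Ext A (ModuleCat A) (n + 1)).obj (Opposite.op M)).obj Y, Function.Surjective q ∧
      ∀ z, q z = 0 ↔ ∃ v : P.complex.X n ⟶ Y, P.complex.d (n + 1) n ≫ v = z.1 := by
  let K := P.complex.linearYonedaObj A Y
  obtain ⟨q, hq, hq0⟩ := sc_homology (K.sc' n (n + 1) (n + 2))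
  let e := (P.isoExt (R := A) (n + 1) Y) ≪≫ K.homologyIsoSc' n (n + 1) (n + 2) (by simp) (by simp)
  exact ⟨e.toLinearEquiv.symm.toLinearMap ∘ₗ q, e.toLinearEquiv.symm.surjective.comp hq,
    fun z => (LinearEquiv.map_eq_zero_iff e.toLinearEquiv.symm).trans (hq0 z)⟩

/-- resolution by finite free modules, as concrete linear maps -/
structure FRes (A M : Type) [CommRing A] [AddCommGroup M] [Module A M] where
  b : ℕ → ℕ
  D : ∀ n, (Fin (b (n + 1)) → A) →ₗ[A] (Fin (b n) → A)
  ep : (Fin (b 0) → A) →ₗ[A] M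
  ep_surj : Function.Surjective ep
  ex0 : ∀ x, ep x = 0 ↔ ∃ y, D 0 y = x
  ex : ∀ n x, D n x = 0 ↔ ∃ y, D (n + 1) y = x

variable {M : Type} [AddCommGroup M] [Module A M]

theorem exists_FRes [IsNoetherianRing A] [Module.Finite A M] : Nonempty (FRes A M) := by
  have step : ∀ (s : Σ m : ℕ, Submodule A (Fin m → A)), ∃ m : ℕ,
      ∃ φ : (Fin m → A) →ₗ[A] (Fin s.1 → A), LinearMap.range φ = s.2 := by
    rintro ⟨m, K⟩
    obtain ⟨m', φ, hφ⟩ := Module.Finite.exists_fin' A K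
    refine ⟨m', K.subtype ∘ₗ φ, ?_⟩
    rw [LinearMap.range_comp, LinearMap.range_eq_top.2 hφ, Submodule.map_top, Submodule.range_subtype]
  choose m φ hφ using step
  obtain ⟨m0, ep, hep⟩ := Module.Finite.exists_fin' A M
  let st : ℕ → Σ m : ℕ, Submodule A (Fin m → A) := fun n =>
    Nat.rec ⟨m0, LinearMap.ker ep⟩ (fun _ s => ⟨m s, LinearMap.ker (φ s)⟩) n
  refine ⟨⟨fun n => (st n).1, fun n => φ (st n), ep, hep, fun x => ?_, fun n x => ?_⟩⟩
  · rw [← LinearMap.mem_ker, ← LinearMap.mem_range, hφ (st 0)]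
    exact Iff.rfl
  · rw [← LinearMap.mem_ker, ← LinearMap.mem_range, hφ (st (n + 1))]

/-- the associated projective resolution -/
noncomputable def FRes.cx (F : FRes A M) : ChainComplex (ModuleCat.{0} A) ℕ :=
  ChainComplex.of (fun n => ModuleCat.of A (Fin (F.b n) → A)) (fun n => ModuleCat.ofHom (F.D n))
    (fun n => by
      ext x
      exact congrFun ((F.ex n _).2 ⟨_, rfl⟩) _)

theorem FRes.cx_d (F : FRes A M) (n : ℕ) : F.cx.d (n + 1) n = ModuleCat.ofHom (F.D n) := by
  unfold FRes.cx
  exact ChainComplex.of_d (α := ℕ) (fun n => ModuleCat.of A (Fin (F.b n) → A))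
    (fun n => ModuleCat.ofHom (F.D n)) n

theorem exists_projRes (F : FRes A M) :
    ∃ P : ProjectiveResolution (ModuleCat.of A M), P.complex = F.cx := by
  have h0 : F.cx.d 1 0 ≫ ModuleCat.ofHom F.ep = 0 := by
    rw [F.cx_d]
    ext x
    exact (F.ex0 _).2 ⟨_, rfl⟩
  have hk := ChainComplex.toSingle₀Equiv_symm_apply_f_zero (C := F.cx) (X := ModuleCat.of A M)
    (ModuleCat.ofHom F.ep) h0
  refine ⟨{ complex := F.cx
            projective := ?_
            π := (ChainComplex.toSingle₀Equiv _ _).symm ⟨ModuleCat.ofHom F.ep, h0⟩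
            quasiIso := ⟨fun n => ?_⟩ }, rfl⟩
  · intro n
    exact ModuleCat.projective_of_free (M := ModuleCat.of A (Fin (F.b n) → A)) (Pi.basisFun A _)
  · cases n with
    | zero =>
      rw [ChainComplex.quasiIsoAt₀_iff, ShortComplex.quasiIso_iff_of_zeros']
      · refine ⟨?_, ?_⟩
        · rw [ShortComplex.moduleCat_exact_iff]
          intro x hx
          obtain ⟨y, hy⟩ := (F.ex0 x).1 ((congrArg (fun g => g.hom x) hk).symm.trans hx)
          refine ⟨y, ?_⟩
          change F.cx.d _ _ y = _
          rw [F.cx_d]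
          exact hy
        · rw [ModuleCat.epi_iff_surjective]
          intro m
          obtain ⟨x, hx⟩ := F.ep_surj m
          exact ⟨x, (congrArg (fun g => g.hom x) hk).trans hx⟩
      all_goals rfl
    | succ n =>
      rw [quasiIsoAt_iff_exactAt']
      · rw [HomologicalComplex.exactAt_iff' _ (n + 1 + 1) (n + 1) n (by simp) (by simp)]
        rw [ShortComplex.moduleCat_exact_iff]
        intro x hx
        change F.cx.d _ _ x = 0 at hx
        rw [F.cx_d] at hx
        obtain ⟨y, hy⟩ := (F.ex _ x).1 hx
        refine ⟨y, ?_⟩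
        change F.cx.d _ _ y = _
        rw [F.cx_d]
        exact hy
      · apply ChainComplex.exactAt_succ_single_obj

/-- cocycles of `Hom(F,Y)` in degree `n+1` -/
def FRes.Z (F : FRes A M) (Y : Type) [AddCommGroup Y] [Module A Y] (n : ℕ) :
    Submodule A ((Fin (F.b (n + 1)) → A) →ₗ[A] Y) :=
  LinearMap.ker (LinearMap.lcomp A Y (F.D (n + 1)))

theorem ext_FRes (F : FRes A M) (Y : Type) [AddCommGroup Y] [Module A Y] (n : ℕ) :
    ∃ q : F.Z Y n →ₗ[A] extAP A M Y (n + 1), Function.Surjective q ∧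
      ∀ z, q z = 0 ↔ ∃ v : (Fin (F.b n) → A) →ₗ[A] Y, v ∘ₗ F.D n = z.1 := by
  obtain ⟨P, hP⟩ := exists_projRes F
  obtain ⟨q, hq, hq0⟩ := ext_res (Y := ModuleCat.of A Y) P n
  obtain ⟨C, pr, w, qi⟩ := P
  dsimp only at hP
  subst hP
  dsimp only at q hq hq0
  have hd : ∀ z : F.cx.X (n + 1) ⟶ ModuleCat.of A Y,
      (z ∈ LinearMap.ker (Linear.leftComp A (ModuleCat.of A Y) (F.cx.d (n + 2) (n + 1)))) ↔
        z.hom ∘ₗ F.D (n + 1) = 0 := by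
    intro z
    rw [LinearMap.mem_ker, Linear.leftComp_apply]
    refine Iff.trans (b := F.cx.d (n + 2) (n + 1) ≫ z = 0) Iff.rfl ?_
    rw [F.cx_d (n + 1)]
    exact ⟨fun h => congrArg ModuleCat.Hom.hom h, fun h => ModuleCat.hom_ext h⟩
  have hd2 : ∀ (v : F.cx.X n ⟶ ModuleCat.of A Y) (z : (Fin (F.b (n + 1)) → A) →ₗ[A] Y),
      (F.cx.d (n + 1) n ≫ v = ModuleCat.ofHom z) ↔ v.hom ∘ₗ F.D n = z := by
    intro v z
    rw [F.cx_d n]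
    exact ⟨fun h => congrArg ModuleCat.Hom.hom h, fun h => ModuleCat.hom_ext h⟩
  let g : F.Z Y n →ₗ[A] LinearMap.ker (Linear.leftComp A (ModuleCat.of A Y) (F.cx.d (n + 2) (n + 1))) :=
    { toFun := fun z => ⟨ModuleCat.ofHom z.1, (hd (ModuleCat.ofHom z.1)).2 (LinearMap.mem_ker.1 z.2)⟩
      map_add' := fun _ _ => rfl
      map_smul' := fun _ _ => rfl }
  have hg : Function.Surjective g := by
    rintro ⟨z, hz⟩
    refine ⟨⟨z.hom, ?_⟩, rfl⟩
    exact LinearMap.mem_ker.2 ((hd z).1 hz)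
  refine ⟨q ∘ₗ g, hq.comp hg, fun z => (hq0 (g z)).trans ?_⟩
  constructor
  · rintro ⟨v, hv⟩
    exact ⟨v.hom, (hd2 _ _).1 hv⟩
  · rintro ⟨v, hv⟩
    exact ⟨ModuleCat.ofHom v, (hd2 _ _).2 hv⟩

end ExtCompute

end CxProof


namespace CxProof

section GradedStep

open DirectSum

theorem graded_step {Q : Type} [CommRing Q] [IsNoetherianRing Q] {f : ℕ → Q} {c : ℕ}
    (V : ℕ → Type) [∀ j, AddCommGroup (V j)] [∀ j, Module Q (V j)] [Module.Finite Q (V 0)]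
    {r : ℕ} (ξ : Fin r → ∀ j, V j →ₗ[Q] V (j + 1))
    (hcomm : ∀ i i' j x, ξ i (j + 1) (ξ i' j x) = ξ i' (j + 1) (ξ i j x))
    (hgen : ∀ j (y : V (j + 1)), ∃ x : Fin r → V j, y = ∑ i, ξ i j (x i))
    (hr : Reg f c) (hf : ∀ i < c, ∀ j (w : V j), f i • w = 0)
    (hVan : ∀ (W : Type) [AddCommGroup W] [Module Q W]
      (X ι : Type) [AddCommGroup X] [Module Q X] (b : Module.Basis ι Q X)
      (gr : ι → ℤ) (d : Module.End Q X) (T : ℕ → Module.End Q X), Lev f 0 b gr d T →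
      ∃ D : ℤ, ∀ n > D, ∀ u : X →ₗ[Q] W, u ∘ₗ pj b gr n = u → u ∘ₗ d = 0 →
        ∃ v : X →ₗ[Q] W, u = v ∘ₗ d)
    {X ι : Type} [AddCommGroup X] [Module Q X] (b : Module.Basis ι Q X)
    (gr : ι → ℤ) (d : Module.End Q X) (T : ℕ → Module.End Q X) (h : Lev f c b gr d T) :
    ∃ j₀, ∀ j ≥ j₀, ∀ n : ℤ, ∀ u : X →ₗ[Q] V (j + 1), u ∘ₗ pj b gr n = u → u ∘ₗ d = 0 →
      ∃ (z : Fin r → (X →ₗ[Q] V j)) (v : X →ₗ[Q] V (j + 1)), (∀ i, z i ∘ₗ d = 0) ∧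
        u = ∑ i, ξ i j ∘ₗ z i + v ∘ₗ d := by
  classical
  let W := ⨁ j, V j
  let Ξ : Fin r → Module.End Q W := fun i =>
    DirectSum.toModule Q ℕ W (fun j => DirectSum.lof Q ℕ V (j + 1) ∘ₗ ξ i j)
  have hΞ : ∀ i j x, Ξ i (DirectSum.lof Q ℕ V j x) = DirectSum.lof Q ℕ V (j + 1) (ξ i j x) := by
    intro i j x
    exact DirectSum.toModule_lof Q (M := V) j x
  have hΞc : ∀ i i', Ξ i * Ξ i' = Ξ i' * Ξ i := by
    intro i i'
    refine DirectSum.linearMap_ext Q fun j => LinearMap.ext fun x => ?_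
    simp only [LinearMap.comp_apply, Module.End.mul_apply, hΞ, hcomm i i']
  let S := Algebra.adjoin Q (Set.range Ξ)
  have hSN : IsNoetherianRing S := al_noeth_adjoin Ξ hΞc
  let _ : CommRing S := Algebra.adjoinCommRingOfComm Q (by
    rintro _ ⟨i, rfl⟩ _ ⟨j, rfl⟩; exact hΞc i j)
  have hΞS : ∀ i, Ξ i ∈ S := fun i => Algebra.subset_adjoin ⟨i, rfl⟩
  have hfin : Module.Finite S W := by
    obtain ⟨s, hs⟩ := (Module.Finite.fg_top : (⊤ : Submodule Q (V 0)).FG)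
    refine ⟨⟨s.image (DirectSum.lof Q ℕ V 0), ?_⟩⟩
    rw [eq_top_iff]
    set P := Submodule.span S ((s.image (DirectSum.lof Q ℕ V 0) : Finset W) : Set W) with hP
    have key : ∀ j x, DirectSum.lof Q ℕ V j x ∈ P := by
      intro j
      induction j with
      | zero =>
        intro x
        have hx : x ∈ Submodule.span Q (s : Set (V 0)) := hs ▸ Submodule.mem_top
        induction hx using Submodule.span_induction with
        | mem x hx =>
          exact Submodule.subset_span (by
            rw [Finset.coe_image]; exact ⟨x, hx, rfl⟩)
        | zero => rw [map_zero]; exact P.zero_mem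
        | add x y _ _ hx hy => rw [map_add]; exact P.add_mem hx hy
        | smul a x _ hx =>
          rw [map_smul]
          exact P.smul_mem (algebraMap Q S a) hx
      | succ j ih =>
        intro x
        obtain ⟨y, rfl⟩ := hgen j x
        rw [map_sum]
        refine P.sum_mem fun i _ => ?_
        rw [← hΞ]
        exact P.smul_mem (⟨Ξ i, hΞS i⟩ : S) (ih (y i))
    intro w _
    induction w using DirectSum.induction_on with
    | zero => exact P.zero_mem
    | of j x => exact key j x
    | add x y hx hy => exact P.add_mem (hx trivial) (hy trivial)
  have hNW : IsNoetherian S W := isNoetherian_of_isNoetherianRing_of_finite S W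
  have hSC : SMulCommClass Q S W := ⟨fun q s w => (map_smul s.1 q w).symm⟩
  have hfW : ∀ i < c, ∀ w : W, f i • w = 0 := by
    intro i hi w
    induction w using DirectSum.induction_on with
    | zero => exact smul_zero _
    | of j x =>
      change f i • DirectSum.lof Q ℕ V j x = 0
      rw [← map_smul, hf i hi, map_zero]
    | add x y hx hy => rw [smul_add, hx, hy, add_zero]
  obtain ⟨G, hGf, hGZ, hG⟩ := main_gen (R := S) (W := W) hr hfW
    (fun X ι _ _ b gr d T h => hVan W X ι b gr d T h) c le_rfl X ι b gr d T h
  -- components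
  let cp : ∀ j, W →ₗ[Q] V j := fun j => DirectSum.component Q ℕ V j
  have hcpΞ : ∀ i j w, cp (j + 1) (Ξ i w) = ξ i j (cp j w) := by
    intro i j w
    induction w using DirectSum.induction_on with
    | zero => simp
    | of k x =>
      change cp (j + 1) (Ξ i (DirectSum.lof Q ℕ V k x)) = ξ i j (cp j (DirectSum.lof Q ℕ V k x))
      rw [hΞ]
      by_cases hk : k = j
      · subst hk
        exact (DirectSum.component.lof_self Q (M := V) (k + 1) _).trans
          (congrArg (ξ i k) (DirectSum.component.lof_self Q (M := V) k x).symm)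
      · simp only [cp]
        rw [DirectSum.component.of, DirectSum.component.of, dif_neg hk, dif_neg (by omega), map_zero]
    | add x y hx hy => simp only [map_add, hx, hy]
  have hbound : ∀ g ∈ G, ∃ J, ∀ j ≥ J, cp j ∘ₗ g = 0 := by
    intro g hg
    obtain ⟨N, hN⟩ := (hGZ g hg).1
    have hz : ∀ i, N < gr i → g (b i) = 0 := by
      intro i hi
      have := LinearMap.congr_fun (hN _ hi) (b i)
      rwa [LinearMap.comp_apply, pj_b, if_pos rfl] at this
    have hw : ∀ w : W, ∃ J, ∀ j ≥ J, cp j w = 0 := by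
      intro w
      refine ⟨(DFinsupp.support w).sup id + 1, fun j hj => ?_⟩
      by_contra hne
      have : j ∈ DFinsupp.support w := DFinsupp.mem_support_iff.2 hne
      have := Finset.le_sup (f := id) this
      simp only [id] at this
      omega
    choose J hJ using hw
    refine ⟨(h.fin N).toFinset.sup (fun i => J (g (b i))), fun j hj => b.ext fun i => ?_⟩
    rw [LinearMap.comp_apply, LinearMap.zero_apply]
    by_cases hi : N < gr i
    · rw [hz i hi, map_zero]
    · exact hJ _ j (le_trans (Finset.le_sup (f := fun i => J (g (b i)))
        ((h.fin N).mem_toFinset.2 (by simpa using hi))) hj)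
  choose! J hJ using hbound
  let j₀ := hGf.toFinset.sup J
  let K : ∀ j, AddSubgroup (X →ₗ[Q] V (j + 1)) := fun j =>
    { carrier := {u | ∃ (z : Fin r → (X →ₗ[Q] V j)) (v : X →ₗ[Q] V (j + 1)), (∀ i, z i ∘ₗ d = 0) ∧
        u = ∑ i, ξ i j ∘ₗ z i + v ∘ₗ d}
      zero_mem' := ⟨0, 0, fun i => by simp, by simp⟩
      add_mem' := by
        rintro _ _ ⟨z, v, hz, rfl⟩ ⟨z', v', hz', rfl⟩
        refine ⟨z + z', v + v', fun i => ?_, ?_⟩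
        · rw [Pi.add_apply, LinearMap.add_comp, hz, hz', add_zero]
        · simp only [Pi.add_apply, LinearMap.comp_add, LinearMap.add_comp, Finset.sum_add_distrib]
          abel
      neg_mem' := by
        rintro _ ⟨z, v, hz, rfl⟩
        refine ⟨-z, -v, fun i => ?_, ?_⟩
        · rw [Pi.neg_apply, LinearMap.neg_comp, hz, neg_zero]
        · simp only [Pi.neg_apply, LinearMap.comp_neg, LinearMap.neg_comp, Finset.sum_neg_distrib]
          abel }
  have hKT : ∀ j, ∀ u ∈ K j, ∀ i < c, u ∘ₗ T i ∈ K j := by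
    rintro j _ ⟨z, v, hz, rfl⟩ i hi
    refine ⟨fun l => z l ∘ₗ T i, v ∘ₗ T i, fun l => ?_, ?_⟩
    · rw [← h.dT hr le_rfl (fun i hi w => hf i hi j w) hi, hz, LinearMap.zero_comp]
    · rw [← h.dT hr le_rfl (fun i hi w => hf i hi (j + 1) w) hi, LinearMap.add_comp]
      congr 1
      ext x
      simp
  have hKq : ∀ j, ∀ u ∈ K j, ∀ q : Q, q • u ∈ K j := by
    rintro j _ ⟨z, v, hz, rfl⟩ q
    refine ⟨q • z, q • v, fun l => ?_, ?_⟩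
    · rw [Pi.smul_apply, LinearMap.smul_comp, hz, smul_zero]
    · rw [smul_add, Finset.smul_sum, LinearMap.smul_comp]
      congr 1
      refine Finset.sum_congr rfl fun i _ => ?_
      rw [Pi.smul_apply, LinearMap.comp_smul]
  let Uset : Set (X →ₗ[Q] W) := {u | u ∈ Zc W S b gr d ∧ ∀ j ≥ j₀, cp (j + 1) ∘ₗ u ∈ K j}
  have hUadd : ∀ u ∈ Uset, ∀ v ∈ Uset, u + v ∈ Uset := by
    rintro u ⟨hu, hu'⟩ v ⟨hv, hv'⟩
    refine ⟨add_mem hu hv, fun j hj => ?_⟩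
    rw [LinearMap.comp_add]
    exact add_mem (hu' j hj) (hv' j hj)
  have hUsm : ∀ s : S, ∀ u ∈ Uset, s • u ∈ Uset := by
    rintro ⟨s, hs⟩
    induction hs using Algebra.adjoin_induction with
    | mem s hs =>
      obtain ⟨i, rfl⟩ := hs
      rintro u ⟨hu, hu'⟩
      refine ⟨Submodule.smul_mem _ _ hu, fun j hj => ?_⟩
      refine ⟨Pi.single i (cp j ∘ₗ u), 0, fun l => ?_, ?_⟩
      · by_cases hl : l = i
        · subst hl
          rw [Pi.single_eq_same, LinearMap.comp_assoc, (mem_Zc.1 hu).2, LinearMap.comp_zero]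
        · rw [Pi.single_eq_of_ne hl, LinearMap.zero_comp]
      · rw [LinearMap.zero_comp, add_zero, Finset.sum_eq_single i]
        · rw [Pi.single_eq_same]
          ext x
          exact hcpΞ i j (u x)
        · intro l _ hl
          rw [Pi.single_eq_of_ne hl, LinearMap.comp_zero]
        · simp
    | algebraMap q =>
      rintro u ⟨hu, hu'⟩
      refine ⟨Submodule.smul_mem _ _ hu, fun j hj => ?_⟩
      have := hKq j _ (hu' j hj) q
      convert this using 1
      ext x
      exact map_smul (cp (j + 1)) q (u x)
    | add s t hs ht ihs iht =>
      intro u hu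
      have := hUadd _ (ihs u hu) _ (iht u hu)
      exact this
    | mul s t hs ht ihs iht =>
      intro u hu
      exact ihs _ (iht u hu)
  let U : Submodule S (X →ₗ[Q] W) :=
    { carrier := Uset
      add_mem' := fun {u v} hu hv => hUadd u hu v hv
      zero_mem' := ⟨zero_mem _, fun j _ => by rw [LinearMap.comp_zero]; exact zero_mem _⟩
      smul_mem' := fun s u hu => hUsm s u hu }
  have hZU : Zc W S b gr d ≤ U := by
    refine hG U ?_ ?_ ?_
    · rintro u hu
      refine ⟨h.Bc_le le_rfl hfW hu, fun j _ => ?_⟩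
      obtain ⟨v, hv, rfl⟩ := hu
      exact ⟨0, cp (j + 1) ∘ₗ v, fun i => by simp, by
        ext x; simp⟩
    · intro g hg
      refine ⟨hGZ g hg, fun j hj => ?_⟩
      rw [hJ g hg]
      · exact zero_mem _
      · exact le_trans (Finset.le_sup (f := J) (hGf.mem_toFinset.2 hg)) (by omega)
    · rintro i hi u ⟨hu, hu'⟩
      refine ⟨h.Zc_T hr le_rfl hfW hi hu, fun j hj => ?_⟩
      rw [← LinearMap.comp_assoc]
      exact hKT j _ (hu' j hj) i hi
  refine ⟨j₀, fun j hj n u hun hud => ?_⟩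
  have hu : DirectSum.lof Q ℕ V (j + 1) ∘ₗ u ∈ Zc W S b gr d := by
    refine mem_Zc.2 ⟨?_, ?_⟩
    · rw [← hun, ← LinearMap.comp_assoc]
      exact Ef_pj _ n
    · rw [LinearMap.comp_assoc, hud, LinearMap.comp_zero]
  have := (hZU hu).2 j hj
  have e : cp (j + 1) ∘ₗ DirectSum.lof Q ℕ V (j + 1) ∘ₗ u = u := by
    ext x
    exact DirectSum.component.lof_self Q (M := V) (j + 1) (u x)
  rw [e] at this
  exact this

end GradedStep

end CxProof


namespace CxProof

section FlatStep

open TensorProduct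

variable {A B : Type} [CommRing A] [CommRing B] [Algebra A B]

/-- matrix acting on vectors -/
def mact {s q : ℕ} (m : Fin s → Fin q → A) (Y : Type) [AddCommGroup Y] [Module A Y] :
    (Fin q → Y) →ₗ[A] (Fin s → Y) where
  toFun v l := ∑ i, m l i • v i
  map_add' v w := by ext l; simp [Finset.sum_add_distrib]
  map_smul' a v := by ext l; simp [Finset.smul_sum, smul_comm a]

variable (B) in
/-- coordinatewise base change -/
def one1 {q : ℕ} {Y : Type} [AddCommGroup Y] [Module A Y] (v : Fin q → Y) : Fin q → B ⊗[A] Y :=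
  fun i => 1 ⊗ₜ[A] v i

variable (B) in
/-- span of the base change -/
def Bsp {q : ℕ} {Y : Type} [AddCommGroup Y] [Module A Y] (K : Submodule A (Fin q → Y)) :
    Submodule B (Fin q → B ⊗[A] Y) :=
  Submodule.span B (one1 B '' (K : Set (Fin q → Y)))

theorem fl_ker [Module.Flat A B] {s q : ℕ} (m : Fin s → Fin q → A) (Y : Type) [AddCommGroup Y]
    [Module A Y] (v : Fin q → B ⊗[A] Y) (hv : ∀ l, ∑ i, m l i • v i = 0) :
    v ∈ Bsp B (LinearMap.ker (mact m Y)) := by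
  let e : ∀ p : ℕ, B ⊗[A] (Fin p → Y) ≃ₗ[B] (Fin p → B ⊗[A] Y) := fun p =>
    TensorProduct.piRight A B B (fun _ : Fin p => Y)
  have hee : ∀ (p : ℕ) (β : B) (y : Fin p → Y), e p (β ⊗ₜ y) = fun i => β ⊗ₜ y i := by
    intro p β y
    exact TensorProduct.piRight_apply _ _ _ _ _
  have hnat : ∀ t, e s ((mact m Y).lTensor B t) = fun l => ∑ i, m l i • e q t i := by
    intro t
    induction t using TensorProduct.induction_on with
    | zero => ext l; simp
    | tmul β y =>
      rw [LinearMap.lTensor_tmul, hee, hee]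
      ext l
      simp [mact, TensorProduct.tmul_sum, TensorProduct.tmul_smul]
    | add x y hx hy =>
      rw [map_add, map_add, hx, hy, map_add]
      ext l
      simp [Finset.sum_add_distrib]
  have hex : Function.Exact ((LinearMap.ker (mact m Y)).subtype.lTensor B) ((mact m Y).lTensor B) :=
    Module.Flat.lTensor_exact B (LinearMap.exact_subtype_ker_map _)
  have h0 : (mact m Y).lTensor B ((e q).symm v) = 0 := by
    apply (e s).injective
    rw [hnat, map_zero, LinearEquiv.apply_symm_apply]
    exact funext hv
  obtain ⟨t, ht⟩ := (hex _).1 h0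
  have hv' : v = e q ((LinearMap.ker (mact m Y)).subtype.lTensor B t) := by
    rw [ht, LinearEquiv.apply_symm_apply]
  rw [hv']
  clear ht hv' h0
  induction t using TensorProduct.induction_on with
  | zero => rw [map_zero, map_zero]; exact zero_mem _
  | tmul β y =>
    rw [LinearMap.lTensor_tmul, hee]
    have : (fun i => β ⊗ₜ[A] ((LinearMap.ker (mact m Y)).subtype y i)) = β • one1 B y.1 := by
      ext i
      simp [one1, TensorProduct.smul_tmul']
    rw [this]
    exact Submodule.smul_mem _ _ (Submodule.subset_span ⟨y.1, y.2, rfl⟩)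
  | add x y hx hy => rw [map_add, map_add]; exact add_mem hx hy

theorem fl_desc [Module.FaithfullyFlat A B] {q : ℕ} {Y : Type} [AddCommGroup Y]
    [Module A Y] (K : Submodule A (Fin q → Y)) (z : Fin q → Y) (hz : one1 B z ∈ Bsp B K) :
    z ∈ K := by
  let e : B ⊗[A] (Fin q → Y) ≃ₗ[B] (Fin q → B ⊗[A] Y) :=
    TensorProduct.piRight A B B (fun _ : Fin q => Y)
  have hee : ∀ (y : Fin q → Y), e (1 ⊗ₜ y) = one1 B y := by
    intro y
    exact TensorProduct.piRight_apply _ _ _ _ _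
  let g : (Fin q → B ⊗[A] Y) →ₗ[B] B ⊗[A] ((Fin q → Y) ⧸ K) :=
    (K.mkQ.baseChange B) ∘ₗ e.symm.toLinearMap
  have hg : ∀ y : Fin q → Y, g (one1 B y) = 1 ⊗ₜ K.mkQ y := by
    intro y
    rw [← hee]
    simp [g]
  have h0 : g (one1 B z) = 0 := by
    have : Bsp B K ≤ LinearMap.ker g := by
      refine Submodule.span_le.2 ?_
      rintro _ ⟨k, hk, rfl⟩
      change g _ = 0
      rw [hg, Submodule.mkQ_apply, (Submodule.Quotient.mk_eq_zero K).2 hk, TensorProduct.tmul_zero]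
    exact this hz
  rw [hg] at h0
  have := Module.FaithfullyFlat.tensorProduct_mk_injective (A := A) (B := B) ((Fin q → Y) ⧸ K)
    (a₁ := K.mkQ z) (a₂ := 0) (by simpa using h0)
  exact (Submodule.Quotient.mk_eq_zero K).1 this

end FlatStep

end CxProof


namespace CxProof

section LevStep

open TensorProduct

variable {A B Q M : Type} [CommRing A] [CommRing B] [CommRing Q] [Algebra A B]
  [AddCommGroup M] [Module A M]

/-- matrix entries of the resolution -/
def FRes.mat (F : FRes A M) (n : ℕ) (l : Fin (F.b n)) (i : Fin (F.b (n + 1))) : A :=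
  F.D n (Pi.single i 1) l

theorem FRes.D_apply (F : FRes A M) (n : ℕ) (x : Fin (F.b (n + 1)) → A) (l : Fin (F.b n)) :
    F.D n x l = ∑ i, F.mat n l i * x i := by
  classical
  have hx : x = ∑ i, x i • (Pi.single i 1 : Fin (F.b (n + 1)) → A) := by
    ext j
    simp [Finset.sum_apply, Pi.single_apply]
  conv_lhs => rw [hx]
  rw [map_sum, Finset.sum_apply]
  refine Finset.sum_congr rfl fun i _ => ?_
  rw [map_smul, Pi.smul_apply, smul_eq_mul, mul_comm]
  rfl

theorem FRes.mat_sq (F : FRes A M) (n : ℕ) (l : Fin (F.b n)) (k : Fin (F.b (n + 2))) :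
    ∑ i, F.mat n l i * F.mat (n + 1) i k = 0 := by
  have h := (F.ex n (F.D (n + 1) (Pi.single k 1))).2 ⟨_, rfl⟩
  have h2 := congrFun h l
  rw [F.D_apply] at h2
  exact h2

theorem FRes.exB [Module.Flat A B] (F : FRes A M) (n : ℕ) (x : Fin (F.b (n + 1)) → B)
    (hx : ∀ l, ∑ i, F.mat n l i • x i = 0) :
    ∃ y : Fin (F.b (n + 2)) → B, ∀ l, x l = ∑ i, F.mat (n + 1) l i • y i := by
  let e : B ⊗[A] A ≃ₗ[B] B := TensorProduct.AlgebraTensorModule.rid A B B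
  have h1 := fl_ker (B := B) (F.mat n) A (fun i => x i ⊗ₜ 1) (fun l => by
    simp only [TensorProduct.smul_tmul']
    rw [← TensorProduct.sum_tmul, hx, TensorProduct.zero_tmul])
  let P : Submodule B (Fin (F.b (n + 1)) → B ⊗[A] A) :=
    { carrier := {v | ∃ y : Fin (F.b (n + 2)) → B, ∀ l, e (v l) = ∑ i, F.mat (n + 1) l i • y i}
      add_mem' := by
        rintro v w ⟨y, hy⟩ ⟨y', hy'⟩
        exact ⟨y + y', fun l => by simp [hy, hy', Finset.sum_add_distrib]⟩
      zero_mem' := ⟨0, fun l => by simp⟩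
      smul_mem' := by
        rintro β v ⟨y, hy⟩
        exact ⟨β • y, fun l => by
          rw [Pi.smul_apply, map_smul, hy, Finset.smul_sum]
          exact Finset.sum_congr rfl fun i _ => smul_comm _ _ _⟩ }
  have hP : Bsp B (LinearMap.ker (mact (F.mat n) A)) ≤ P := by
    refine Submodule.span_le.2 ?_
    rintro _ ⟨k, hk, rfl⟩
    obtain ⟨y, hy⟩ := (F.ex n k).1 (by
      ext l
      rw [F.D_apply]
      exact congrFun hk l)
    refine ⟨fun i => algebraMap A B (y i), fun l => ?_⟩
    rw [← hy]
    simp only [e, one1, F.D_apply, TensorProduct.AlgebraTensorModule.rid_tmul, Algebra.smul_def,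
      map_sum, map_mul, mul_one]
  obtain ⟨y, hy⟩ := hP h1
  refine ⟨y, fun l => ?_⟩
  rw [← hy l]
  simp [e]

/-- index set of the lifted resolution -/
abbrev FRes.ix (F : FRes A M) : Type := Σ n, Fin (F.b n)

/-- degrees -/
def FRes.gr (F : FRes A M) : F.ix → ℤ := fun p => (p.1 : ℤ)

/-- basis -/
noncomputable abbrev FRes.bs (F : FRes A M) (Q : Type) [CommRing Q] :
    Module.Basis F.ix Q (F.ix →₀ Q) :=
  Finsupp.basisSingleOne

/-- image of the basis under the lifted differential -/
noncomputable def FRes.d0 (F : FRes A M) (L : ∀ n, Fin (F.b n) → Fin (F.b (n + 1)) → Q) :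
    F.ix → (F.ix →₀ Q)
  | ⟨0, _⟩ => 0
  | ⟨n + 1, i⟩ => ∑ l, Finsupp.single ⟨n, l⟩ (L n l i)

/-- lifted differential -/
noncomputable def FRes.dd (F : FRes A M) (L : ∀ n, Fin (F.b n) → Fin (F.b (n + 1)) → Q) :
    Module.End Q (F.ix →₀ Q) :=
  (F.bs Q).constr Q (F.d0 L)

theorem FRes.dd_b (F : FRes A M) (L : ∀ n, Fin (F.b n) → Fin (F.b (n + 1)) → Q) (p : F.ix) :
    F.dd L (F.bs Q p) = F.d0 L p := by
  rw [FRes.dd, Module.Basis.constr_basis]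

theorem FRes.dd_apply (F : FRes A M) (L : ∀ n, Fin (F.b n) → Fin (F.b (n + 1)) → Q)
    (x : F.ix →₀ Q) (n : ℕ) (l : Fin (F.b n)) :
    F.dd L x ⟨n, l⟩ = ∑ i, L n l i * x ⟨n + 1, i⟩ := by
  classical
  have key : Finsupp.lapply (⟨n, l⟩ : F.ix) ∘ₗ F.dd L =
      ∑ i, L n l i • Finsupp.lapply (⟨n + 1, i⟩ : F.ix) := by
    refine (F.bs Q).ext fun p => ?_
    rw [LinearMap.comp_apply, F.dd_b, LinearMap.sum_apply]
    rcases p with ⟨m, j⟩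
    cases m with
    | zero =>
      simp only [FRes.d0, map_zero, LinearMap.smul_apply, Finsupp.lapply_apply,
        Finsupp.coe_basisSingleOne]
      symm
      refine Finset.sum_eq_zero fun i _ => ?_
      rw [Finsupp.single_eq_of_ne (by rintro h; cases h), smul_zero]
    | succ m =>
      simp only [FRes.d0, map_sum, LinearMap.smul_apply, Finsupp.lapply_apply,
        Finsupp.coe_basisSingleOne]
      by_cases h : m = n
      · subst h
        rw [Finset.sum_eq_single l, Finset.sum_eq_single j]
        · simp
        · intro i _ hi
          rw [Finsupp.single_eq_of_ne (by rintro h; cases h; exact hi rfl), smul_zero]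
        · simp
        · intro i _ hi
          rw [Finsupp.single_eq_of_ne (by rintro h; cases h; exact hi rfl)]
        · simp
      · rw [Finset.sum_eq_zero, Finset.sum_eq_zero]
        · intro i _
          rw [Finsupp.single_eq_of_ne (by rintro h'; cases h'; exact h rfl), smul_zero]
        · intro i _
          rw [Finsupp.single_eq_of_ne (by rintro h'; cases h'; exact h rfl)]
  have := LinearMap.congr_fun key x
  simpa [LinearMap.sum_apply] using this

theorem FRes.lev [Module.Flat A B] (F : FRes A M) (π : Q →+* B) (hπ : Function.Surjective π)
    {f : ℕ → Q} {c : ℕ} (hk : ∀ x, π x = 0 ↔ x ∈ JS f c Q)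
    (L : ∀ n, Fin (F.b n) → Fin (F.b (n + 1)) → Q)
    (hL : ∀ n l i, π (L n l i) = algebraMap A B (F.mat n l i)) :
    ∃ T, Lev f c (F.bs Q) F.gr (F.dd L) T := by
  classical
  have hd : Hm (F.bs Q) F.gr (-1) (F.dd L) := by
    rw [Hm_iff]
    rintro ⟨m, j⟩ ⟨n, l⟩ hne
    have hne' : F.dd L (F.bs Q ⟨m, j⟩) ⟨n, l⟩ ≠ 0 := hne
    rw [F.dd_apply] at hne'
    obtain ⟨i, _, hi⟩ := Finset.exists_ne_zero_of_sum_ne_zero hne'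
    have h3 : m = n + 1 := by
      by_contra h3
      apply hi
      rw [Finsupp.coe_basisSingleOne, Finsupp.single_eq_of_ne (by rintro h; cases h; exact h3 rfl),
        mul_zero]
    simp [FRes.gr, h3]
  have hsq : ∀ x : F.ix →₀ Q, ∀ p, π (F.dd L (F.dd L x) p) = 0 := by
    rintro x ⟨n, l⟩
    rw [F.dd_apply]
    simp only [F.dd_apply, map_sum, map_mul, hL, Finset.mul_sum]
    rw [Finset.sum_comm]
    refine Finset.sum_eq_zero fun k _ => ?_
    simp only [← mul_assoc, ← map_mul]
    rw [← Finset.sum_mul, ← map_sum, F.mat_sq, map_zero, zero_mul]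
  obtain ⟨T, hT, hTe⟩ : OJ f (F.bs Q) F.gr c (-2) (F.dd L * F.dd L) := by
    refine OJ_of_coeff ((hd.mul hd).cast (by norm_num)) fun p q => ?_
    exact (hk _).1 (hsq _ _)
  refine ⟨T, hd, hT, hTe, fun p => ?_, fun N => ?_, ?_⟩
  · exact Int.natCast_nonneg _
  · refine Set.Finite.subset (s := ⋃ n ∈ Set.Iic N.toNat, Set.range (fun i => (⟨n, i⟩ : F.ix))) ?_ ?_
    · exact Set.Finite.biUnion (Set.finite_Iic _) fun n _ => Set.finite_range _
    · rintro ⟨n, i⟩ hp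
      have hp' : (n : ℤ) ≤ N := hp
      simp only [Set.mem_iUnion]
      exact ⟨n, by rw [Set.mem_Iic]; omega, i, rfl⟩
  · intro n hn x hx hdx
    obtain ⟨m, rfl⟩ : ∃ m : ℕ, n = (m : ℤ) + 1 := ⟨(n - 1).toNat, by omega⟩
    obtain ⟨y, hy⟩ := F.exB (B := B) m (fun i => π (x ⟨m + 1, i⟩)) (fun l => by
      have := (hk _).2 ((JS_repr (F.bs Q)).1 hdx ⟨m, l⟩)
      change π (F.dd L x ⟨m, l⟩) = 0 at this
      rw [F.dd_apply] at this
      simpa [hL, Algebra.smul_def] using this)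
    choose s hs using hπ
    let z : F.ix →₀ Q := ∑ i, Finsupp.single (⟨m + 2, i⟩ : F.ix) (s (y i))
    refine ⟨z, (JS_repr (F.bs Q)).2 ?_⟩
    have hz : ∀ (i : Fin (F.b (m + 2))), z ⟨m + 2, i⟩ = s (y i) := by
      intro i
      simp only [z, Finsupp.finset_sum_apply]
      rw [Finset.sum_eq_single i]
      · simp
      · intro j _ hj
        rw [Finsupp.single_eq_of_ne (by rintro h; cases h; exact hj rfl)]
      · simp
    have hz' : ∀ (k : ℕ) (hk : k ≠ m + 2) (i : Fin (F.b k)), z ⟨k, i⟩ = 0 := by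
      intro k hk i
      simp only [z, Finsupp.finset_sum_apply]
      refine Finset.sum_eq_zero fun j _ => ?_
      rw [Finsupp.single_eq_of_ne (by rintro h; cases h; exact hk rfl)]
    rintro ⟨k, l⟩
    rw [← hk]
    change π ((x - F.dd L z) ⟨k, l⟩) = 0
    rw [Finsupp.sub_apply, F.dd_apply, map_sub]
    by_cases hkm : k = m + 1
    · subst hkm
      rw [hy l]
      simp [hz, hL, hs, Algebra.smul_def]
    · have hx0 : x ⟨k, l⟩ = 0 := by
        have := repr_pj (F.bs Q) F.gr ((m : ℤ) + 1) x ⟨k, l⟩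
        rw [hx, if_neg (by simp only [FRes.gr]; omega)] at this
        exact this
      rw [hx0, map_zero, zero_sub, neg_eq_zero, map_sum]
      refine Finset.sum_eq_zero fun i _ => ?_
      rw [hz' (k + 1) (by omega), mul_zero, map_zero]

end LevStep

end CxProof


namespace CxProof

section CombStep

open TensorProduct

variable {A B Q M : Type} [CommRing A] [CommRing B] [CommRing Q] [Algebra A B]
  [AddCommGroup M] [Module A M]

/-- linear map from values on the standard basis -/
noncomputable def lc {q : ℕ} {Y : Type} [AddCommGroup Y] [Module A Y] (v : Fin q → Y) :
    (Fin q → A) →ₗ[A] Y := Fintype.linearCombination A v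

theorem lc_single {q : ℕ} {Y : Type} [AddCommGroup Y] [Module A Y] (v : Fin q → Y) (i : Fin q) :
    lc (A := A) v (Pi.single i 1) = v i := by
  rw [lc, Fintype.linearCombination_apply_single, one_smul]

theorem lc_ext {q : ℕ} {Y : Type} [AddCommGroup Y] [Module A Y] {z w : (Fin q → A) →ₗ[A] Y}
    (h : ∀ i, z (Pi.single i 1) = w (Pi.single i 1)) : z = w := by
  refine (Pi.basisFun A (Fin q)).ext fun i => ?_
  simpa using h i

theorem FRes.comp_D (F : FRes A M) {Y : Type} [AddCommGroup Y] [Module A Y] (n : ℕ)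
    (z : (Fin (F.b n) → A) →ₗ[A] Y) (i : Fin (F.b (n + 1))) :
    z (F.D n (Pi.single i 1)) = ∑ l, F.mat n l i • z (Pi.single l 1) := by
  have : F.D n (Pi.single i 1) = ∑ l, F.mat n l i • (Pi.single l 1 : Fin (F.b n) → A) := by
    ext j
    simp [Finset.sum_apply, Pi.single_apply, FRes.mat]
  rw [this, map_sum]
  simp only [map_smul]

theorem comb_step [IsLocalRing Q] [IsNoetherianRing Q] [Module.FaithfullyFlat A B] (F : FRes A M)
    (π : Q →+* B) (hπ : Function.Surjective π)
    {f : ℕ → Q} {c : ℕ} (hk : ∀ x, π x = 0 ↔ x ∈ JS f c Q) (hr : Reg f c)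
    {g : ℕ → Q} {D : ℕ} (hg : Reg g D)
    (hgm : ∀ x, x ∈ IsLocalRing.maximalIdeal Q ↔ x ∈ JS g D Q)
    (Y : ℕ → Type) [∀ j, AddCommGroup (Y j)] [∀ j, Module A (Y j)] [Module.Finite A (Y 0)]
    {r : ℕ} (ξ : Fin r → ∀ j, Y j →ₗ[A] Y (j + 1))
    (hcomm : ∀ i i' j x, ξ i (j + 1) (ξ i' j x) = ξ i' (j + 1) (ξ i j x))
    (hgen : ∀ j (y : Y (j + 1)), ∃ x : Fin r → Y j, y = ∑ i, ξ i j (x i)) :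
    ∃ j₀, ∀ j ≥ j₀, ∀ n, ∀ z ∈ F.Z (Y (j + 1)) n,
      ∃ (zi : Fin r → F.Z (Y j) n) (v : (Fin (F.b n) → A) →ₗ[A] Y (j + 1)),
        z = ∑ i, ξ i j ∘ₗ (zi i).1 + v ∘ₗ F.D n := by
  classical
  let _ : Algebra Q B := π.toAlgebra
  have hsm : ∀ (q : Q) (β : B), q • β = π q * β := fun q β => rfl
  have : SMulCommClass A Q B := ⟨fun a q β => by
    rw [hsm, hsm, mul_smul_comm]⟩
  have : SMulCommClass Q A B := SMulCommClass.symm _ _ _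
  have hsm2 : ∀ j (q : Q) (w : B ⊗[A] Y j), q • w = π q • w := by
    intro j q w
    induction w using TensorProduct.induction_on with
    | zero => rw [smul_zero, smul_zero]
    | tmul β y =>
      rw [TensorProduct.smul_tmul', TensorProduct.smul_tmul', hsm, smul_eq_mul]
    | add x y hx hy => rw [smul_add, smul_add, hx, hy]
  have hfinB : Module.Finite Q B :=
    Module.Finite.of_surjective (Algebra.linearMap Q B) hπ
  have htow : IsScalarTower Q B (B ⊗[A] Y 0) := ⟨fun q β w => by
    rw [hsm, hsm2, mul_smul]⟩
  have hfin0 : Module.Finite Q (B ⊗[A] Y 0) := Module.Finite.trans B _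
  let Ξ : Fin r → ∀ j, B ⊗[A] Y j →ₗ[Q] B ⊗[A] Y (j + 1) := fun i j =>
    { toFun := (ξ i j).baseChange B
      map_add' := map_add _
      map_smul' := fun q w => by
        rw [hsm2, hsm2, map_smul]; rfl }
  have hΞ : ∀ i j w, Ξ i j w = (ξ i j).baseChange B w := fun _ _ _ => rfl
  choose s hs using hπ
  let L : ∀ n, Fin (F.b n) → Fin (F.b (n + 1)) → Q := fun n l i => s (algebraMap A B (F.mat n l i))
  have hL : ∀ n l i, π (L n l i) = algebraMap A B (F.mat n l i) := fun n l i => hs _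
  obtain ⟨T, hlev⟩ := F.lev π (fun x => ⟨s x, hs x⟩) hk L hL
  have hLsm : ∀ n l i j (w : B ⊗[A] Y j), L n l i • w = F.mat n l i • w := by
    intro n l i j w
    rw [hsm2, hL, algebraMap_smul]
  obtain ⟨j₀, hj₀⟩ := graded_step (f := f) (c := c) (fun j => B ⊗[A] Y j) Ξ
    (by
      intro i i' j x
      simp only [hΞ]
      rw [← LinearMap.comp_apply, ← LinearMap.comp_apply, ← LinearMap.baseChange_comp,
        ← LinearMap.baseChange_comp]
      congr 2
      ext y
      exact hcomm i i' j y)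
    (by
      intro j w
      induction w using TensorProduct.induction_on with
      | zero => exact ⟨0, by simp⟩
      | tmul β y =>
        obtain ⟨x, rfl⟩ := hgen j y
        exact ⟨fun i => β ⊗ₜ x i, by simp [hΞ, TensorProduct.tmul_sum]⟩
      | add x y hx hy =>
        obtain ⟨x, rfl⟩ := hx
        obtain ⟨y, rfl⟩ := hy
        exact ⟨x + y, by simp [Finset.sum_add_distrib]⟩)
    hr
    (by
      intro i hi j w
      rw [hsm2, (hk (f i)).2 ⟨Pi.single i 1, by
        rw [Finset.sum_eq_single i]
        · simp
        · intro l _ hl; simp [hl]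
        · intro h; exact absurd (Finset.mem_range.2 hi) h⟩, zero_smul])
    (fun W _ _ X ι _ _ b gr d T h => van h hg hgm W)
    (F.bs Q) F.gr (F.dd L) T hlev
  refine ⟨j₀, fun j hj n z hz => ?_⟩
  -- values on the basis
  have hval : ∀ (m : ℕ) (j : ℕ) (u : (F.ix →₀ Q) →ₗ[Q] B ⊗[A] Y j) (i : Fin (F.b (m + 1))),
      u (F.dd L (F.bs Q ⟨m + 1, i⟩)) = ∑ l, F.mat m l i • u (F.bs Q ⟨m, l⟩) := by
    intro m j u i
    rw [F.dd_b]
    simp only [FRes.d0, map_sum]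
    refine Finset.sum_congr rfl fun l _ => ?_
    rw [← hLsm, ← map_smul]
    simp
  let zv : Fin (F.b (n + 1)) → Y (j + 1) := fun i => z (Pi.single i 1)
  let u : (F.ix →₀ Q) →ₗ[Q] B ⊗[A] Y (j + 1) := (F.bs Q).constr Q (fun p =>
    if h : p.1 = n + 1 then 1 ⊗ₜ zv (h ▸ p.2) else 0)
  have hu1 : ∀ i, u (F.bs Q ⟨n + 1, i⟩) = 1 ⊗ₜ zv i := by
    intro i
    simp only [u, Module.Basis.constr_basis]
    simp
  have hu0 : ∀ p : F.ix, p.1 ≠ n + 1 → u (F.bs Q p) = 0 := by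
    intro p hp
    simp only [u, Module.Basis.constr_basis]
    rw [dif_neg hp]
  obtain ⟨w, v, hw, huv⟩ := hj₀ j hj ((n : ℤ) + 1) u
    (by
      refine (F.bs Q).ext fun p => ?_
      rw [LinearMap.comp_apply, pj_b]
      split_ifs with h
      · rfl
      · rw [map_zero, hu0]
        intro h'
        apply h
        simp [FRes.gr, h'])
    (by
      refine (F.bs Q).ext fun p => ?_
      rw [LinearMap.comp_apply, LinearMap.zero_apply]
      rcases p with ⟨m, i⟩
      cases m with
      | zero => rw [F.dd_b]; simp [FRes.d0]
      | succ m =>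
        rw [hval]
        by_cases hm : m = n + 1
        · subst hm
          simp only [hu1, ← TensorProduct.tmul_smul]
          rw [← TensorProduct.tmul_sum, ← F.comp_D]
          have : z (F.D (n + 1) (Pi.single i 1)) = 0 :=
            LinearMap.congr_fun (LinearMap.mem_ker.1 hz) _
          rw [this, TensorProduct.tmul_zero]
        · refine Finset.sum_eq_zero fun l _ => ?_
          rw [hu0 _ hm, smul_zero])
  -- descent
  let KZ : Submodule A (Fin (F.b (n + 1)) → Y j) :=
    LinearMap.ker (mact (fun i l => F.mat (n + 1) l i) (Y j))
  let φ : (Fin r → KZ) →ₗ[A] (Fin (F.b (n + 1)) → Y (j + 1)) :=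
    ∑ i, (ξ i j).compLeft (Fin (F.b (n + 1))) ∘ₗ KZ.subtype ∘ₗ LinearMap.proj i
  let ψ : (Fin (F.b n) → Y (j + 1)) →ₗ[A] (Fin (F.b (n + 1)) → Y (j + 1)) :=
    mact (fun i l => F.mat n l i) (Y (j + 1))
  let K : Submodule A (Fin (F.b (n + 1)) → Y (j + 1)) := LinearMap.range φ ⊔ LinearMap.range ψ
  have hzK : zv ∈ K := by
    refine fl_desc (B := B) K zv ?_
    have e : one1 B zv = ∑ i, ((ξ i j).baseChange B).compLeft (Fin (F.b (n + 1)))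
        (fun l => w i (F.bs Q ⟨n + 1, l⟩)) +
        fun i => ∑ l, F.mat n l i • v (F.bs Q ⟨n, l⟩) := by
      ext i
      rw [Pi.add_apply, Finset.sum_apply, ← hval]
      change 1 ⊗ₜ zv i = _
      rw [← hu1, huv, LinearMap.add_apply, LinearMap.sum_apply]
      rfl
    rw [e]
    refine add_mem (sum_mem fun i _ => ?_) ?_
    · have h1 : (fun l => w i (F.bs Q ⟨n + 1, l⟩)) ∈ Bsp B KZ := by
        refine fl_ker _ _ _ fun l => ?_
        rw [← hval]
        exact LinearMap.congr_fun (hw i) _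
      have h2 : Bsp B KZ ≤ (Bsp B K).comap (((ξ i j).baseChange B).compLeft (Fin (F.b (n + 1)))) := by
        refine Submodule.span_le.2 ?_
        rintro _ ⟨k, hk, rfl⟩
        refine Submodule.subset_span ⟨φ (Pi.single i ⟨k, hk⟩), Submodule.mem_sup_left ⟨_, rfl⟩, ?_⟩
        ext l
        simp only [φ, LinearMap.sum_apply, one1]
        rw [Finset.sum_eq_single i]
        · simp [one1]
        · intro i' _ hi'
          simp [hi']
        · simp
      exact h2 h1
    · have h1 : (fun l => v (F.bs Q ⟨n, l⟩)) ∈ Bsp B (LinearMap.ker (mact (A := A)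
          (fun (i : Fin 0) (l : Fin (F.b n)) => (0 : A)) (Y (j + 1)))) := by
        exact fl_ker _ _ _ fun l => l.elim0
      let θ : (Fin (F.b n) → B ⊗[A] Y (j + 1)) →ₗ[B] (Fin (F.b (n + 1)) → B ⊗[A] Y (j + 1)) :=
        { toFun := fun w i => ∑ l, F.mat n l i • w l
          map_add' := fun w w' => by ext i; simp [Finset.sum_add_distrib]
          map_smul' := fun β w => by
            ext i
            simp only [Pi.smul_apply, RingHom.id_apply, Finset.smul_sum]
            exact Finset.sum_congr rfl fun l _ => smul_comm _ _ _ }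
      have h2 : Bsp B (LinearMap.ker (mact (A := A)
          (fun (i : Fin 0) (l : Fin (F.b n)) => (0 : A)) (Y (j + 1)))) ≤ (Bsp B K).comap θ := by
        refine Submodule.span_le.2 ?_
        rintro _ ⟨k, hk, rfl⟩
        refine Submodule.subset_span ⟨ψ k, Submodule.mem_sup_right ⟨_, rfl⟩, ?_⟩
        ext l
        simp [θ, ψ, mact, one1, TensorProduct.tmul_sum, TensorProduct.tmul_smul]
      exact h2 h1
  obtain ⟨_, ⟨zi, rfl⟩, _, ⟨y, rfl⟩, hzy⟩ := Submodule.mem_sup.1 hzK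
  refine ⟨fun i => ⟨lc (zi i).1, ?_⟩, lc y, ?_⟩
  · refine LinearMap.mem_ker.2 (lc_ext fun l => ?_)
    change lc (zi i).1 (F.D (n + 1) (Pi.single l 1)) = 0
    rw [F.comp_D]
    simp only [lc_single]
    exact congrFun (zi i).2 l
  · refine lc_ext fun l => ?_
    have := congrFun hzy l
    change _ = z (Pi.single l 1) at this
    rw [← this, Pi.add_apply, LinearMap.add_apply, LinearMap.comp_apply (lc y), F.comp_D]
    simp only [lc_single]
    congr 1
    simp only [φ, LinearMap.sum_apply, Finset.sum_apply]
    refine Finset.sum_congr rfl fun i _ => ?_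
    rw [LinearMap.comp_apply (ξ i j), lc_single]
    rfl

end CombStep

end CxProof


namespace CxProof

section FinalStep

open TensorProduct CategoryTheory

theorem minGens_le {A : Type} [CommRing A] [IsLocalRing A] {H H' : Type} [AddCommGroup H]
    [Module A H] [AddCommGroup H'] [Module A H'] [Module.Finite A H] (r : ℕ)
    (φ : (Fin r → H) →ₗ[A] H') (hφ : Function.Surjective φ) :
    minGens A H' ≤ r * minGens A H := by
  let k := IsLocalRing.ResidueField A
  have h1 : Module.finrank k (k ⊗[A] (Fin r → H)) = r * minGens A H := by
    rw [(TensorProduct.piRight A k k (fun _ : Fin r => H)).finrank_eq, Module.finrank_pi_fintype]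
    simp [minGens, k]
  rw [← h1]
  exact LinearMap.finrank_le_finrank_of_surjective (f := φ.baseChange k)
    (LinearMap.lTensor_surjective k hφ)

theorem JS_eq_span {Q : Type} [CommRing Q] (f : ℕ → Q) (k : ℕ) :
    JS f k Q = Ideal.span (f '' Set.Iio k) := by
  apply le_antisymm
  · rintro _ ⟨c, rfl⟩
    refine sum_mem fun i hi => ?_
    rw [smul_eq_mul]
    exact Ideal.mul_mem_right _ _ (Ideal.subset_span ⟨i, Finset.mem_range.1 hi, rfl⟩)
  · refine Ideal.span_le.2 ?_
    rintro _ ⟨i, hi, rfl⟩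
    refine ⟨Pi.single i 1, ?_⟩
    rw [Finset.sum_eq_single i]
    · simp
    · intro l _ hl; simp [hl]
    · intro h; exact absurd (Finset.mem_range.2 hi) h

theorem reg_of_isRegular {Q : Type} [CommRing Q] {c : ℕ} (f : Fin c → Q)
    (hreg : RingTheory.Sequence.IsRegular Q (List.ofFn f)) :
    ∃ f' : ℕ → Q, Reg f' c ∧ JS f' c Q = Ideal.span (Set.range f) := by
  let f' : ℕ → Q := fun i => if h : i < c then f ⟨i, h⟩ else 0
  have hf' : ∀ i (h : i < c), f' i = f ⟨i, h⟩ := fun i h => dif_pos h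
  refine ⟨f', fun k hk y hy => ?_, ?_⟩
  · have h1 := hreg.toIsWeaklyRegular.regular_mod_prev k (by simpa using hk)
    have hI : (Ideal.ofList ((List.ofFn f).take k) • (⊤ : Submodule Q Q)) = JS f' k Q := by
      rw [smul_eq_mul, Ideal.mul_top, JS_eq_span]
      unfold Ideal.ofList
      congr 1
      ext x
      simp only [List.mem_take_iff_getElem, Set.mem_image, Set.mem_Iio]
      constructor
      · rintro ⟨i, hi, rfl⟩
        simp only [List.length_ofFn, lt_min_iff] at hi
        exact ⟨i, hi.1, by rw [hf' i hi.2, List.getElem_ofFn]⟩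
      · rintro ⟨i, hi, rfl⟩
        exact ⟨i, by simp only [List.length_ofFn, lt_min_iff]; omega, by
          rw [hf' i (by omega), List.getElem_ofFn]⟩
    rw [hI, List.getElem_ofFn, ← hf' k hk] at h1
    have h2 : (Submodule.Quotient.mk y : Q ⧸ JS f' k Q) = 0 := by
      apply h1
      change f' k • (Submodule.Quotient.mk y : Q ⧸ JS f' k Q) = f' k • (0 : Q ⧸ JS f' k Q)
      rw [smul_zero, ← Submodule.Quotient.mk_smul, Submodule.Quotient.mk_eq_zero]
      exact hy
    exact (Submodule.Quotient.mk_eq_zero _).1 h2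
  · rw [JS_eq_span]
    congr 1
    ext x
    constructor
    · rintro ⟨i, hi, rfl⟩
      exact ⟨⟨i, hi⟩, (hf' i hi).symm⟩
    · rintro ⟨i, rfl⟩
      exact ⟨i.1, i.2, hf' i.1 i.2⟩

theorem stab_sInf (S : ℕ → Set ℕ) (j₀ : ℕ) (h : ∀ j ≥ j₀, S j ⊆ S (j + 1)) :
    ∃ j₁, ∀ j ≥ j₁, sInf (S j) = sInf (S j₁) := by
  by_cases hne : ∃ j ≥ j₀, (S j).Nonempty
  · obtain ⟨j₁, hj₁, hn⟩ := hne
    have hmono : ∀ j ≥ j₀, ∀ k, S j ⊆ S (j + k) := by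
      intro j hj k
      induction k with
      | zero => exact subset_rfl
      | succ k ih => exact ih.trans (h (j + k) (by omega))
    let a : ℕ → ℕ := fun k => sInf (S (j₁ + k))
    obtain ⟨k, hk⟩ : ∃ k, ∀ l, a k ≤ a l := by
      obtain ⟨m, ⟨k, rfl⟩, hm⟩ := WellFounded.has_min (wellFounded_lt (α := ℕ)) (Set.range a) ⟨_, 0, rfl⟩
      exact ⟨k, fun l => not_lt.1 (hm _ ⟨l, rfl⟩)⟩
    refine ⟨j₁ + k, fun j hj => le_antisymm ?_ ?_⟩
    · have h1 : (S (j₁ + k)).Nonempty := hn.mono (hmono j₁ hj₁ k)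
      obtain ⟨l, rfl⟩ := Nat.exists_eq_add_of_le hj
      exact Nat.sInf_le (hmono (j₁ + k) (by omega) l (Nat.sInf_mem h1))
    · obtain ⟨l, rfl⟩ := Nat.exists_eq_add_of_le hj
      have := hk (k + l)
      simp only [a, ← add_assoc] at this
      exact this
  · push Not at hne
    refine ⟨j₀, fun j hj => ?_⟩
    rw [hne j hj, hne j₀ le_rfl]

theorem cx_subset {A : Type} [CommRing A] [IsLocalRing A] {M N N' : Type} [AddCommGroup M]
    [Module A M] [AddCommGroup N] [Module A N] [AddCommGroup N'] [Module A N'] (r : ℕ)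
    (h : ∀ n, minGens A (extAP A M N' (n + 1)) ≤ r * minGens A (extAP A M N (n + 1))) :
    { b : ℕ | Filter.limsup (fun n : ℕ =>
      (minGens A (extAP A M N n) : ENNReal) / (n : ENNReal) ^ ((b : ℤ) - 1))
      Filter.atTop < ⊤ } ⊆
    { b : ℕ | Filter.limsup (fun n : ℕ =>
      (minGens A (extAP A M N' n) : ENNReal) / (n : ENNReal) ^ ((b : ℤ) - 1))
      Filter.atTop < ⊤ } := by
  intro b hb
  simp only [Set.mem_ofPred_eq] at hb ⊢
  refine lt_of_le_of_lt (Filter.limsup_le_limsup (v := fun n : ℕ => (r : ENNReal) *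
    ((minGens A (extAP A M N n) : ENNReal) / (n : ENNReal) ^ ((b : ℤ) - 1))) ?_) ?_
  · filter_upwards [Filter.eventually_ge_atTop 1] with n hn
    obtain ⟨m, rfl⟩ : ∃ m, n = m + 1 := ⟨n - 1, by omega⟩
    rw [← mul_div_assoc]
    refine ENNReal.div_le_div_right ?_ _
    exact_mod_cast h m
  · rw [ENNReal.limsup_const_mul_of_ne_top (ENNReal.natCast_ne_top r)]
    exact ENNReal.mul_lt_top (ENNReal.natCast_lt_top r) hb

theorem ext_step {A : Type} [CommRing A] [IsLocalRing A] [IsNoetherianRing A] {M : Type}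
    [AddCommGroup M] [Module A M] (F : FRes A M) {Y Y' : Type} [AddCommGroup Y] [Module A Y]
    [AddCommGroup Y'] [Module A Y'] [Module.Finite A Y] {r : ℕ} (ξ : Fin r → Y →ₗ[A] Y') (n : ℕ)
    (h : ∀ z ∈ F.Z Y' n, ∃ (zi : Fin r → F.Z Y n) (v : (Fin (F.b n) → A) →ₗ[A] Y'),
        z = ∑ i, ξ i ∘ₗ (zi i).1 + v ∘ₗ F.D n) :
    minGens A (extAP A M Y' (n + 1)) ≤ r * minGens A (extAP A M Y (n + 1)) := by
  obtain ⟨q, hq, hq0⟩ := ext_FRes F Y n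
  obtain ⟨q', hq', hq0'⟩ := ext_FRes F Y' n
  have : IsNoetherian A (F.Z Y n) := inferInstance
  have : Module.Finite A (extAP A M Y (n + 1)) := Module.Finite.of_surjective q hq
  let g : Fin r → F.Z Y n →ₗ[A] F.Z Y' n := fun i =>
    { toFun := fun z => ⟨ξ i ∘ₗ z.1, LinearMap.mem_ker.2 (by
        have := LinearMap.mem_ker.1 z.2
        change z.1 ∘ₗ F.D (n + 1) = 0 at this
        change (ξ i ∘ₗ z.1) ∘ₗ F.D (n + 1) = 0
        rw [LinearMap.comp_assoc, this, LinearMap.comp_zero])⟩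
      map_add' := fun x y => Subtype.ext (LinearMap.comp_add _ _ _)
      map_smul' := fun a x => Subtype.ext (LinearMap.comp_smul _ _ _) }
  have hk : ∀ i, LinearMap.ker q ≤ LinearMap.ker (q' ∘ₗ g i) := by
    intro i z hz
    obtain ⟨v, hv⟩ := (hq0 z).1 hz
    refine (hq0' _).2 ⟨ξ i ∘ₗ v, ?_⟩
    rw [LinearMap.comp_assoc, hv]
    rfl
  let φ : Fin r → extAP A M Y (n + 1) →ₗ[A] extAP A M Y' (n + 1) := fun i =>
    ((LinearMap.ker q).liftQ (q' ∘ₗ g i) (hk i)) ∘ₗ (q.quotKerEquivOfSurjective hq).symm.toLinearMap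
  have hφ : ∀ i z, φ i (q z) = q' (g i z) := by
    intro i z
    have : (q.quotKerEquivOfSurjective hq).symm (q z) = Submodule.Quotient.mk z := by
      rw [LinearEquiv.symm_apply_eq]
      rfl
    change (LinearMap.ker q).liftQ (q' ∘ₗ g i) (hk i) ((q.quotKerEquivOfSurjective hq).symm (q z)) = _
    rw [this]
    rfl
  refine minGens_le r (∑ i, φ i ∘ₗ LinearMap.proj i) ?_
  intro e
  obtain ⟨z, rfl⟩ := hq' e
  obtain ⟨zi, v, hz⟩ := h z.1 z.2
  refine ⟨fun i => q (zi i), ?_⟩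
  rw [LinearMap.sum_apply]
  have e1 : ∀ i, (φ i ∘ₗ LinearMap.proj i) (fun i => q (zi i)) = q' (g i (zi i)) :=
    fun i => hφ i (zi i)
  rw [Finset.sum_congr rfl fun i _ => e1 i, ← map_sum, ← sub_eq_zero, ← map_sub, hq0']
  refine ⟨-v, ?_⟩
  rw [Submodule.coe_sub, hz, Submodule.coe_sum, LinearMap.neg_comp]
  change _ = ∑ i, ξ i ∘ₗ (zi i).1 - _
  abel

end FinalStep

end CxProof

/-- Let `(A, 𝔪)` be a local complete intersection (the completion `Â` is
`Q/(f_1,…,f_c)` with `(Q, 𝔫)` regular local and `f_1,…,f_c ∈ 𝔫²` a `Q`-regular sequence).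
For finitely generated `A`-modules `M, N` and a proper ideal `I` of `A`, the complexity
`cx_A(M, IʲN)` is constant for all large `j`. -/
theorem stmt12 (A : Type) [CommRing A] [IsLocalRing A] [IsNoetherianRing A]
    (Q : Type) [CommRing Q] [IsLocalRing Q] [IsNoetherianRing Q]
    -- `Q` is regular local: its maximal ideal is generated by `dim Q` elements
    (hQreg : ∃ s : Finset Q, Ideal.span (s : Set Q) = IsLocalRing.maximalIdeal Q ∧
      (s.card : WithBot ℕ∞) = ringKrullDim Q)
    (π : Q →+* AdicCompletion (IsLocalRing.maximalIdeal A) A)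
    (hπ : Function.Surjective π)
    (c : ℕ) (f : Fin c → Q)
    (hreg : RingTheory.Sequence.IsRegular Q (List.ofFn f))
    (hf2 : ∀ j : Fin c, f j ∈ (IsLocalRing.maximalIdeal Q) ^ 2)
    (hker : RingHom.ker π = Ideal.span (Set.range f))
    (M N : Type) [AddCommGroup M] [Module A M] [Module.Finite A M]
    [AddCommGroup N] [Module A N] [Module.Finite A N]
    (I : Ideal A) (hI : I ≠ ⊤) :
    ∃ j₀ : ℕ, ∀ j ≥ j₀,
      complexity A M (↥(I ^ j • (⊤ : Submodule A N))) =
        complexity A M (↥(I ^ j₀ • (⊤ : Submodule A N))) := by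
  obtain ⟨s, hs, hsd⟩ := hQreg
  obtain ⟨-, g, hg, hgm⟩ := CxProof.reg_local s.card Q (fun i => (s.equivFin.symm i : Q))
    (by
      rw [← hs]
      congr 1
      ext x
      constructor
      · rintro ⟨i, rfl⟩
        exact (s.equivFin.symm i).2
      · intro hx
        exact ⟨s.equivFin ⟨x, hx⟩, by simp⟩) hsd.symm
  obtain ⟨f', hf', hJ⟩ := CxProof.reg_of_isRegular f hreg
  have hk : ∀ x, π x = 0 ↔ x ∈ CxProof.JS f' c Q := by
    intro x
    rw [hJ, ← hker, RingHom.mem_ker]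
  have hflat : Module.Flat A (AdicCompletion (IsLocalRing.maximalIdeal A) A) :=
    AdicCompletion.flat_of_isNoetherian _
  have hff : Module.FaithfullyFlat A (AdicCompletion (IsLocalRing.maximalIdeal A) A) :=
    Module.FaithfullyFlat.of_flat_of_isLocalHom
  obtain ⟨F⟩ := CxProof.exists_FRes (A := A) (M := M)
  obtain ⟨r, a, ha⟩ := Submodule.fg_iff_exists_fin_generating_family.1
    ((isNoetherianRing_iff_ideal_fg A).1 inferInstance I)
  have hsucc : ∀ j, I ^ (j + 1) • (⊤ : Submodule A N) = I • (I ^ j • (⊤ : Submodule A N)) := by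
    intro j
    rw [pow_succ', ← smul_eq_mul, Submodule.smul_assoc]
  have haI : ∀ i, a i ∈ I := fun i => ha ▸ Submodule.subset_span ⟨i, rfl⟩
  let ξ : Fin r → ∀ j, ↥(I ^ j • (⊤ : Submodule A N)) →ₗ[A] ↥(I ^ (j + 1) • (⊤ : Submodule A N)) :=
    fun i j =>
    { toFun := fun x => ⟨a i • x.1, by
        rw [hsucc]
        exact Submodule.smul_mem_smul (haI i) x.2⟩
      map_add' := fun x y => Subtype.ext (smul_add _ _ _)
      map_smul' := fun t x => Subtype.ext (smul_comm _ _ _) }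
  obtain ⟨j₀, hj₀⟩ := CxProof.comb_step F π hπ hk hf' hg hgm
    (fun j => ↥(I ^ j • (⊤ : Submodule A N))) ξ
    (fun i i' j x => Subtype.ext (smul_comm _ _ _))
    (by
      intro j y
      let P : (Fin r → ↥(I ^ j • (⊤ : Submodule A N))) →ₗ[A] ↥(I ^ (j + 1) • (⊤ : Submodule A N)) :=
        ∑ i, ξ i j ∘ₗ LinearMap.proj i
      have hP : ∀ x, P x = ∑ i, ξ i j (x i) := fun x => by
        simp only [P, LinearMap.sum_apply]; rfl
      have h1 : I ^ (j + 1) • (⊤ : Submodule A N) ≤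
          (LinearMap.range P).map (I ^ (j + 1) • (⊤ : Submodule A N)).subtype := by
        conv_lhs => rw [hsucc]
        refine Submodule.smul_le.2 fun t ht p hp => ?_
        rw [← ha] at ht
        obtain ⟨w, hw⟩ := Ideal.mem_span_range_iff_exists_fun.1 ht
        refine ⟨P (fun i => w i • ⟨p, hp⟩), ⟨_, rfl⟩, ?_⟩
        rw [hP, map_sum, ← hw, Finset.sum_smul]
        refine Finset.sum_congr rfl fun i _ => ?_
        change a i • (w i • p) = _
        rw [smul_smul, mul_comm]
      obtain ⟨_, ⟨x, rfl⟩, hx⟩ := h1 y.2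
      exact ⟨x, by rw [← hP]; exact Subtype.ext hx.symm⟩)
  exact CxProof.stab_sInf _ j₀ fun j hj => CxProof.cx_subset r fun n =>
    CxProof.ext_step F (fun i => ξ i j) n (hj₀ j hj n)
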